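/- arXiv:1712.09861 — 2 statements merged into one kernel-verified Lean document; each statement's English description precedes it below -/
import Mathlib

section
/- Let q be a power of an odd prime p (so p ≥ 3) and let n ≥ 3 be a positive integer with (q, n) ≠ (3, 4). Then there exists an element α ∈ F_{q^n} that is simultaneously 2-primitive and normal over F_q. -/
/-- The `F_q`-span of the conjugates `α, α^q, …, α^{q^{n-1}}` of `α ∈ F_{q^n}`. -/
def conjSpan (K : Type*) {L : Type*} [Field K] [Field L] [Algebra K L]
    (q n : ℕ) (α : L) : Submodule K L :=
  Submodule.span K (Set.range fun i : Fin n => α ^ q ^ (i : ℕ))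

/-- `f = ∑ a_ψ ψ` with all `ψ` occurring trivial on `H`, trivial coefficient `c`, and
`∑ ‖a_ψ‖ ≤ F`. -/
def HasExpansion {Γ : Type*} [AddCommGroup Γ] [Finite Γ] (f : Γ → ℂ) (H : AddSubgroup Γ)
    (c F : ℝ) : Prop :=
  ∃ a : AddChar Γ ℂ → ℂ, (∀ g, f g = ∑ ψ, a ψ * ψ g) ∧
    (∀ ψ, a ψ ≠ 0 → ∀ g ∈ H, ψ g = 1) ∧ a 1 = c ∧ ∑ ψ, ‖a ψ‖ ≤ F

namespace HasExpansion

variable {Γ : Type*} [AddCommGroup Γ] [Finite Γ]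

lemma const (c : ℝ) (hc : 0 ≤ c) : HasExpansion (fun _ : Γ => (c : ℂ)) ⊤ c c := by
  classical
  refine ⟨fun ψ => if ψ = 1 then c else 0, fun g => ?_, fun ψ h g _ => ?_, by simp, ?_⟩
  · simp [ite_mul]
  · by_cases hψ : ψ = 1
    · simp [hψ]
    · simp [hψ] at h
  · simp [apply_ite, abs_of_nonneg hc]

lemma add {f g : Γ → ℂ} {H₁ H₂ : AddSubgroup Γ} {c₁ c₂ F₁ F₂ : ℝ}
    (hf : HasExpansion f H₁ c₁ F₁) (hg : HasExpansion g H₂ c₂ F₂) :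
    HasExpansion (fun x => f x + g x) (H₁ ⊓ H₂) (c₁ + c₂) (F₁ + F₂) := by
  obtain ⟨a, ha, hs, h1, hF⟩ := hf
  obtain ⟨b, hb, hs', h1', hF'⟩ := hg
  refine ⟨fun ψ => a ψ + b ψ, fun x => ?_, fun ψ h x hx => ?_, by simp [h1, h1'], ?_⟩
  · simp only [ha, hb, ← Finset.sum_add_distrib, add_mul]
  · by_cases h0 : a ψ = 0
    · exact hs' ψ (by simpa [h0] using h) x hx.2
    · exact hs ψ h0 x hx.1
  · refine le_trans (Finset.sum_le_sum fun ψ _ => norm_add_le _ _) ?_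
    rw [Finset.sum_add_distrib]
    exact add_le_add hF hF'

lemma neg {f : Γ → ℂ} {H : AddSubgroup Γ} {c F : ℝ} (hf : HasExpansion f H c F) :
    HasExpansion (fun x => - f x) H (-c) F := by
  obtain ⟨a, ha, hs, h1, hF⟩ := hf
  refine ⟨fun ψ => - a ψ, fun x => ?_, fun ψ h x hx => ?_, by simp [h1], by simpa using hF⟩
  · simp [ha]
  · exact hs ψ (by simpa using h) x hx

lemma mul {f g : Γ → ℂ} {H₁ H₂ : AddSubgroup Γ} {c₁ c₂ F₁ F₂ : ℝ}
    (hf : HasExpansion f H₁ c₁ F₁) (hg : HasExpansion g H₂ c₂ F₂) (hH : H₁ ⊔ H₂ = ⊤) :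
    HasExpansion (fun x => f x * g x) (H₁ ⊓ H₂) (c₁ * c₂) (F₁ * F₂) := by
  classical
  obtain ⟨a, ha, hs, h1, hF⟩ := hf
  obtain ⟨b, hb, hs', h1', hF'⟩ := hg
  have key : ∀ h : AddChar Γ ℂ → AddChar Γ ℂ → ℂ,
      ∑ ψ, ∑ φ, h (ψ / φ) φ = ∑ ψ, ∑ φ, h ψ φ := by
    intro h
    rw [Finset.sum_comm, Finset.sum_comm (f := fun ψ φ => h ψ φ)]
    refine Finset.sum_congr rfl fun φ _ => ?_
    exact Fintype.sum_equiv (Equiv.divRight φ) _ _ (fun _ => rfl)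
  have key' : ∀ h : AddChar Γ ℂ → AddChar Γ ℂ → ℝ,
      ∑ ψ, ∑ φ, h (ψ / φ) φ = ∑ ψ, ∑ φ, h ψ φ := by
    intro h
    rw [Finset.sum_comm, Finset.sum_comm (f := fun ψ φ => h ψ φ)]
    refine Finset.sum_congr rfl fun φ _ => ?_
    exact Fintype.sum_equiv (Equiv.divRight φ) _ _ (fun _ => rfl)
  refine ⟨fun ψ => ∑ φ, a (ψ / φ) * b φ, fun x => ?_, fun ψ h x hx => ?_, ?_, ?_⟩
  · dsimp only
    rw [ha, hb, Finset.sum_mul_sum]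
    rw [← key (fun ψ φ => a ψ * ψ x * (b φ * φ x))]
    refine Finset.sum_congr rfl fun ψ _ => ?_
    rw [Finset.sum_mul]
    refine Finset.sum_congr rfl fun φ _ => ?_
    have : ψ x = (ψ / φ) x * φ x := by rw [← AddChar.mul_apply, div_mul_cancel]
    rw [this]; ring
  · obtain ⟨φ, -, hφ⟩ := Finset.exists_ne_zero_of_sum_ne_zero h
    have h2 := hs _ (left_ne_zero_of_mul hφ) x hx.1
    have h3 := hs' _ (right_ne_zero_of_mul hφ) x hx.2
    have : ψ x = (ψ / φ) x * φ x := by rw [← AddChar.mul_apply, div_mul_cancel]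
    rw [this, h2, h3, one_mul]
  · dsimp only
    rw [Finset.sum_eq_single (1 : AddChar Γ ℂ)]
    · simp [h1, h1']
    · intro φ _ hφ
      by_contra hne
      apply hφ
      have h2 := hs _ (left_ne_zero_of_mul hne)
      have h3 := hs' _ (right_ne_zero_of_mul hne)
      rw [AddChar.eq_one_iff]
      intro x
      have hx : x ∈ H₁ ⊔ H₂ := by rw [hH]; trivial
      obtain ⟨y, hy, z, hz, rfl⟩ := AddSubgroup.mem_sup.1 hx
      have h4 := h2 y hy
      rw [one_div, AddChar.inv_apply', inv_eq_one] at h4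
      rw [AddChar.map_add_eq_mul, h4, h3 z hz, one_mul]
    · simp
  · calc ∑ ψ, ‖∑ φ, a (ψ / φ) * b φ‖ ≤ ∑ ψ, ∑ φ, ‖a (ψ / φ)‖ * ‖b φ‖ := by
          refine Finset.sum_le_sum fun ψ _ => (norm_sum_le _ _).trans ?_
          simp
      _ = (∑ ψ, ‖a ψ‖) * ∑ φ, ‖b φ‖ := by
          rw [key' (fun ψ φ => ‖a ψ‖ * ‖b φ‖), Finset.sum_mul_sum]
      _ ≤ F₁ * F₂ := by
          refine mul_le_mul hF hF' (by positivity) ?_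
          exact le_trans (by positivity) hF

/-- The centred indicator function of a subgroup. -/
lemma indicator_sub (H : AddSubgroup Γ) [DecidablePred (· ∈ H)] :
    HasExpansion (fun g => (if g ∈ H then (1 : ℂ) else 0) - ((H.index : ℝ)⁻¹ : ℝ)) H 0
      (1 - (H.index : ℝ)⁻¹) := by
  classical
  have := Fintype.ofFinite (Γ ⧸ H)
  have hidx : H.index = Fintype.card (Γ ⧸ H) := by
    rw [AddSubgroup.index, Nat.card_eq_fintype_card]
  have hpos : (0 : ℝ) < Fintype.card (Γ ⧸ H) := by exact_mod_cast Fintype.card_pos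
  rw [hidx]
  set v : ℝ := (Fintype.card (Γ ⧸ H) : ℝ) with hv
  let e : AddChar (Γ ⧸ H) ℂ → AddChar Γ ℂ := fun ψ => ψ.compAddMonoidHom (QuotientAddGroup.mk' H)
  have he : Function.Injective e :=
    AddChar.compAddMonoidHom_injective_left _ (QuotientAddGroup.mk'_surjective H)
  have he1 : e 1 = 1 := by ext; simp [e]
  set s : Finset (AddChar Γ ℂ) := (Finset.univ.image e).erase 1 with hs
  have hcard : (s.card : ℝ) = v - 1 := by
    rw [hs, Finset.card_erase_of_mem (Finset.mem_image.2 ⟨1, Finset.mem_univ _, he1⟩),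
      Finset.card_image_of_injective _ he, Finset.card_univ, AddChar.card_eq, hv,
      Nat.cast_sub Fintype.card_pos]
    simp
  refine ⟨fun ψ => if ψ ∈ s then ((v⁻¹ : ℝ) : ℂ) else 0, fun g => ?_, fun ψ h g hg => ?_, ?_, ?_⟩
  · simp only [ite_mul, zero_mul]
    rw [Finset.sum_ite_mem, Finset.univ_inter, ← Finset.mul_sum]
    have h1 : ∑ ψ ∈ s, ψ g + 1 = ∑ ψ ∈ Finset.univ.image e, ψ g := by
      rw [hs, ← Finset.sum_erase_add _ _ (Finset.mem_image.2 ⟨1, Finset.mem_univ _, he1⟩)]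
      simp
    rw [Finset.sum_image (fun _ _ _ _ h => he h)] at h1
    have h2 := AddChar.sum_apply_eq_ite (α := Γ ⧸ H) (QuotientAddGroup.mk' H g)
    simp only [e, AddChar.compAddMonoidHom_apply] at h1
    rw [h2] at h1
    have h3 : (QuotientAddGroup.mk' H g = 0) ↔ g ∈ H := by simp
    simp only [h3] at h1
    have hv0 : (v : ℂ) ≠ 0 := by exact_mod_cast hpos.ne'
    have h4 : ∑ ψ ∈ s, ψ g = (if g ∈ H then (v : ℂ) else 0) - 1 := by
      have hvc : (v : ℂ) = Fintype.card (Γ ⧸ H) := by simp [hv]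
      rw [hvc, ← h1]; ring
    rw [h4]
    split_ifs <;> push_cast <;> field_simp
    ring
  · have hψ : ψ ∈ s := by by_contra hc; simp [hc] at h
    obtain ⟨φ, -, rfl⟩ := Finset.mem_image.1 (Finset.mem_of_mem_erase hψ)
    have : (QuotientAddGroup.mk' H) g = 0 := by simpa using hg
    simp only [e, AddChar.compAddMonoidHom_apply, this, AddChar.map_zero_eq_one]
  · simp [hs]
  · simp only [apply_ite, norm_zero]
    rw [Finset.sum_ite_mem, Finset.univ_inter, Finset.sum_const, nsmul_eq_mul, hcard]
    simp only [Complex.norm_real, norm_inv, Real.norm_eq_abs, abs_of_pos hpos]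
    apply le_of_eq
    field_simp

/-- The indicator function of the complement of a subgroup. -/
lemma compl_indicator (H : AddSubgroup Γ) [DecidablePred (· ∈ H)] :
    HasExpansion (fun g => if g ∈ H then (0 : ℂ) else 1) H (1 - (H.index : ℝ)⁻¹)
      (2 * (1 - (H.index : ℝ)⁻¹)) := by
  have hle : (0 : ℝ) ≤ 1 - (H.index : ℝ)⁻¹ := by
    have : (1 : ℝ) ≤ H.index := by
      exact_mod_cast Nat.one_le_iff_ne_zero.2 (AddSubgroup.index_ne_zero_of_finite)
    linarith [inv_le_one_of_one_le₀ this]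
  have := (const (Γ := Γ) _ hle).add (indicator_sub H).neg
  rw [top_inf_eq] at this
  convert this using 1
  · ext g; split_ifs <;> push_cast <;> ring
  · ring
  · ring

lemma sum {ι : Type*} (T : Finset ι) {f : ι → Γ → ℂ} {H : ι → AddSubgroup Γ} {c F : ι → ℝ}
    (h : ∀ i ∈ T, HasExpansion (f i) (H i) (c i) (F i)) :
    HasExpansion (fun x => ∑ i ∈ T, f i x) (T.inf H) (∑ i ∈ T, c i) (∑ i ∈ T, F i) := by
  classical
  induction T using Finset.induction_on with
  | empty => simpa using const (Γ := Γ) 0 le_rfl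
  | insert i T hi ih =>
    simp only [Finset.sum_insert hi, Finset.inf_insert]
    exact (h i (Finset.mem_insert_self _ _)).add
      (ih fun j hj => h j (Finset.mem_insert_of_mem hj))

lemma prod {ι : Type*} (J : Finset ι) {f : ι → Γ → ℂ} {H : ι → AddSubgroup Γ} {c F : ι → ℝ}
    (h : ∀ i ∈ J, HasExpansion (f i) (H i) (c i) (F i))
    (hind : ∀ A ⊆ J, ∀ B ⊆ J, Disjoint A B → A.inf H ⊔ B.inf H = ⊤) :
    HasExpansion (fun x => ∏ i ∈ J, f i x) (J.inf H) (∏ i ∈ J, c i) (∏ i ∈ J, F i) := by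
  classical
  induction J using Finset.induction_on with
  | empty => simpa using const (Γ := Γ) 1 zero_le_one
  | insert i J hi ih =>
    simp only [Finset.prod_insert hi, Finset.inf_insert]
    refine (h i (Finset.mem_insert_self _ _)).mul
      (ih (fun j hj => h j (Finset.mem_insert_of_mem hj)) fun A hA B hB =>
        hind A (hA.trans (Finset.subset_insert i J)) B (hB.trans (Finset.subset_insert i J))) ?_
    simpa using hind {i} (by simp) J (Finset.subset_insert i J) (by simpa using hi)

/-- Along a family of points with small nontrivial character sums, the average of `f` is close to
its trivial coefficient. -/
lemma norm_sum_sub_le {X : Type*} [Fintype X] {f : Γ → ℂ} {H : AddSubgroup Γ} {c F : ℝ}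
    (hf : HasExpansion f H c F) (p : X → Γ) {E : ℝ} (hE : 0 ≤ E)
    (hsum : ∀ ψ : AddChar Γ ℂ, ψ ≠ 1 → ‖∑ x, ψ (p x)‖ ≤ E) :
    ‖∑ x, f (p x) - c * Fintype.card X‖ ≤ F * E := by
  classical
  obtain ⟨a, ha, -, h1, hF⟩ := hf
  have : ∑ x, f (p x) - c * Fintype.card X
      = ∑ ψ ∈ Finset.univ.erase (1 : AddChar Γ ℂ), a ψ * ∑ x, ψ (p x) := by
    simp only [ha]
    rw [Finset.sum_comm]
    simp only [← Finset.mul_sum]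
    rw [← Finset.sum_erase_add _ _ (Finset.mem_univ (1 : AddChar Γ ℂ))]
    simp [h1]
  rw [this]
  calc _ ≤ ∑ ψ ∈ Finset.univ.erase (1 : AddChar Γ ℂ), ‖a ψ‖ * E := by
        refine (norm_sum_le _ _).trans (Finset.sum_le_sum fun ψ hψ => ?_)
        rw [norm_mul]
        exact mul_le_mul_of_nonneg_left (hsum ψ (Finset.ne_of_mem_erase hψ)) (norm_nonneg _)
    _ ≤ ∑ ψ, ‖a ψ‖ * E :=
        Finset.sum_le_sum_of_subset_of_nonneg (Finset.erase_subset _ _)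
          (fun _ _ _ => by positivity)
    _ ≤ F * E := by
        rw [← Finset.sum_mul]
        exact mul_le_mul_of_nonneg_right hF hE

end HasExpansion

/-- Sieve: if the character sums along `p` are small, some point `p x` avoids all the subgroups
`G i`, `i ∈ J ∪ T`. -/
theorem exists_avoiding {Γ X ι : Type*} [AddCommGroup Γ] [Finite Γ] [Fintype X]
    (G : ι → AddSubgroup Γ) (p : X → Γ) {E : ℝ} (hE : 0 ≤ E)
    (hsum : ∀ ψ : AddChar Γ ℂ, ψ ≠ 1 → ‖∑ x, ψ (p x)‖ ≤ E) (J T : Finset ι)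
    (hJT : Disjoint J T) (hG : ∀ i ∈ J, G i ≠ ⊤)
    (hind : ∀ A B : Finset ι, (∀ i ∈ A, i ∈ J ∨ i ∈ T) → (∀ i ∈ B, i ∈ J ∨ i ∈ T) →
      Disjoint A B → A.inf G ⊔ B.inf G = ⊤)
    (δ : ℝ) (hδ : δ = 1 - ∑ i ∈ T, ((G i).index : ℝ)⁻¹) (hδ0 : 0 ≤ δ)
    (hlt : 2 ^ J.card * (2 * δ + T.card - 1) * E < δ * Fintype.card X) :
    ∃ x, ∀ i, i ∈ J ∨ i ∈ T → p x ∉ G i := by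
  classical
  have hf := HasExpansion.prod J (fun i _ => HasExpansion.compl_indicator (G i))
    (fun A hA B hB => hind A B (fun i hi => .inl (hA hi)) fun i hi => .inl (hB hi))
  have hg := (HasExpansion.const (Γ := Γ) δ hδ0).add
    (HasExpansion.sum T (fun i _ => HasExpansion.indicator_sub (G i))).neg
  rw [top_inf_eq] at hg
  have hh := (hf.mul hg
    (hind J T (fun _ => .inl) (fun _ => .inr) hJT)).norm_sum_sub_le p hE hsum
  set θ : ℝ := ∏ i ∈ J, (1 - ((G i).index : ℝ)⁻¹) with hθ
  have hθ0 : 0 < θ := by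
    refine Finset.prod_pos fun i hi => ?_
    have h1 : (G i).index ≠ 1 := by rw [Ne, AddSubgroup.index_eq_one]; exact hG i hi
    have h2 : (G i).index ≠ 0 := AddSubgroup.index_ne_zero_of_finite
    have h3 : (1 : ℝ) < (G i).index := by exact_mod_cast (by omega : 1 < (G i).index)
    linarith [inv_lt_one_of_one_lt₀ h3]
  by_contra hcon
  push Not at hcon
  have hle : ∀ x, ∃ r : ℝ, r ≤ 0 ∧ (∏ i ∈ J, if p x ∈ G i then (0 : ℂ) else 1) *
      (δ + -∑ i ∈ T, ((if p x ∈ G i then (1 : ℂ) else 0) - (((G i).index : ℝ)⁻¹ : ℝ))) = r := by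
    intro x
    refine ⟨(∏ i ∈ J, if p x ∈ G i then (0 : ℝ) else 1) *
      (δ + -∑ i ∈ T, ((if p x ∈ G i then (1 : ℝ) else 0) - ((G i).index : ℝ)⁻¹)), ?_, ?_⟩
    · obtain ⟨i, hi, hx⟩ := hcon x
      rcases hi with hi | hi
      · rw [Finset.prod_eq_zero hi (by simp [hx]), zero_mul]
      · refine mul_nonpos_of_nonneg_of_nonpos
          (Finset.prod_nonneg fun j _ => by split_ifs <;> norm_num) ?_
        rw [hδ, Finset.sum_sub_distrib]
        have : (1 : ℝ) ≤ ∑ i ∈ T, if p x ∈ G i then (1 : ℝ) else 0 := by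
          calc (1 : ℝ) = if p x ∈ G i then (1 : ℝ) else 0 := by simp [hx]
            _ ≤ _ := Finset.single_le_sum (f := fun i => if p x ∈ G i then (1 : ℝ) else 0)
                  (fun j _ => by split_ifs <;> norm_num) hi
        linarith
    · push_cast
      congr 1
      · exact Finset.prod_congr rfl fun i _ => by split_ifs <;> simp
      · congr 2
        exact Finset.sum_congr rfl fun i _ => by split_ifs <;> simp
  choose r hr0 hr using hle
  simp only [hr] at hh
  have h5 : ‖((∑ x, r x - θ * δ * Fintype.card X : ℝ) : ℂ)‖ ≤ θ * 2 ^ J.card *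
      (2 * δ + T.card - 1) * E := by
    convert hh using 1
    · push_cast; simp
    · rw [Finset.prod_mul_distrib, Finset.prod_const, ← hθ]
      simp only [Finset.sum_sub_distrib, Finset.sum_const, nsmul_eq_mul, mul_one]
      have : ∑ i ∈ T, ((G i).index : ℝ)⁻¹ = 1 - δ := by rw [hδ]; ring
      rw [this]; ring
  rw [Complex.norm_real, Real.norm_eq_abs] at h5
  have h6 : ∑ x, r x ≤ 0 := Finset.sum_nonpos fun x _ => hr0 x
  have h7 := (abs_le.1 h5).1
  have h8 : θ * δ * Fintype.card X ≤ θ * (2 ^ J.card * (2 * δ + T.card - 1) * E) := by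
    linarith
  rw [mul_assoc] at h8
  exact absurd (le_of_mul_le_mul_left h8 hθ0) (not_le.2 hlt)

lemma card_units_sq_eq_le_two {L : Type*} [Field L] [Fintype L] [DecidableEq L] (c : L) :
    (Finset.univ.filter fun x : Lˣ => (x : L) ^ 2 = c).card ≤ 2 := by
  have h := Polynomial.card_nthRoots 2 c
  refine le_trans ?_ ((Multiset.toFinset_card_le _).trans h)
  refine Finset.card_le_card_of_injOn (fun x : Lˣ => (x : L)) (fun x hx => ?_)
    (fun _ _ _ _ h => Units.ext h)
  simpa [Polynomial.mem_nthRoots] using hx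

/-- Sums of a multiplicative character times an additive character of the square. -/
theorem norm_sum_char_sq_le {L : Type*} [Field L] [Fintype L] [DecidableEq L]
    (χ : AddChar (Additive Lˣ) ℂ) (φ : AddChar L ℂ) (hφ : φ ≠ 1) :
    ‖∑ x : Lˣ, χ (Additive.ofMul x) * φ ((x : L) ^ 2)‖ ≤ 2 * √(Fintype.card L) := by
  classical
  set Q : ℝ := (Fintype.card L : ℝ) with hQ
  set N : ℝ := (Fintype.card Lˣ : ℝ) with hN
  have hN0 : 0 < N := by rw [hN]; exact_mod_cast Fintype.card_pos
  have hprim : φ.IsPrimitive := AddChar.IsPrimitive.of_ne_one hφ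
  let S : L → ℂ := fun y => ∑ x : Lˣ, χ (Additive.ofMul x) * φ (y * (x : L) ^ 2)
  have hχ : ∀ x, ‖χ x‖ = 1 := fun x => AddChar.norm_apply χ x
  have hsum : ∑ y, (‖S y‖ ^ 2 : ℝ) ≤ 2 * Q * N := by
    have h1 : ((∑ y, (‖S y‖ ^ 2 : ℝ) : ℝ) : ℂ) = ∑ x : Lˣ, ∑ x' : Lˣ,
        χ (Additive.ofMul x) * (starRingEnd ℂ) (χ (Additive.ofMul x')) *
          (if (x' : L) ^ 2 = (x : L) ^ 2 then (Q : ℂ) else 0) := by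
      push_cast
      have h2 : ∀ y, (‖S y‖ : ℂ) ^ 2 = ∑ x : Lˣ, ∑ x' : Lˣ,
          χ (Additive.ofMul x) * (starRingEnd ℂ) (χ (Additive.ofMul x')) *
            φ (y * ((x : L) ^ 2 - (x' : L) ^ 2)) := by
        intro y
        rw [← Complex.mul_conj', map_sum, Finset.sum_mul_sum]
        refine Finset.sum_congr rfl fun x _ => Finset.sum_congr rfl fun x' _ => ?_
        rw [mul_sub, sub_eq_add_neg, AddChar.map_add_eq_mul, AddChar.map_neg_eq_conj,
          map_mul (starRingEnd ℂ)]
        ring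
      simp only [h2]
      rw [Finset.sum_comm]
      refine Finset.sum_congr rfl fun x _ => ?_
      rw [Finset.sum_comm]
      refine Finset.sum_congr rfl fun x' _ => ?_
      rw [← Finset.mul_sum, AddChar.sum_mulShift _ hprim]
      congr 1
      by_cases h : (x' : L) ^ 2 = (x : L) ^ 2
      · simp [h, hQ]
      · have : (x : L) ^ 2 - (x' : L) ^ 2 ≠ 0 := sub_ne_zero.2 (Ne.symm h)
        simp [h, this]
    have h3 : ∑ y, (‖S y‖ ^ 2 : ℝ) = ‖((∑ y, (‖S y‖ ^ 2 : ℝ) : ℝ) : ℂ)‖ := by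
      rw [Complex.norm_real, Real.norm_of_nonneg (by positivity)]
    rw [h3, h1]
    calc _ ≤ ∑ x : Lˣ, ∑ x' : Lˣ, (if (x' : L) ^ 2 = (x : L) ^ 2 then Q else 0) := by
          refine (norm_sum_le _ _).trans (Finset.sum_le_sum fun x _ => ?_)
          refine (norm_sum_le _ _).trans (Finset.sum_le_sum fun x' _ => ?_)
          rw [norm_mul, norm_mul, RCLike.norm_conj, hχ, hχ]
          split_ifs <;> simp [hQ]
      _ ≤ ∑ x : Lˣ, 2 * Q := by
          refine Finset.sum_le_sum fun x _ => ?_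
          rw [← Finset.sum_filter, Finset.sum_const, nsmul_eq_mul]
          refine mul_le_mul_of_nonneg_right ?_ (by positivity)
          exact Nat.cast_le_ofNat.2 (card_units_sq_eq_le_two _)
      _ = 2 * Q * N := by rw [Finset.sum_const, nsmul_eq_mul, Finset.card_univ, ← hN]; ring
  have hS : ∀ z : Lˣ, ‖S ((z : L) ^ 2)‖ = ‖S 1‖ := by
    intro z
    have : χ (Additive.ofMul z) * S ((z : L) ^ 2) = S 1 := by
      simp only [S, Finset.mul_sum]
      refine Fintype.sum_equiv (Equiv.mulLeft z) _ _ fun x => ?_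
      rw [Equiv.coe_mulLeft, ofMul_mul, AddChar.map_add_eq_mul, Units.val_mul, mul_pow, one_mul]
      ring
    rw [← this, norm_mul, hχ, one_mul]
  have hle : N * ‖S 1‖ ^ 2 ≤ 2 * (2 * Q * N) := by
    calc N * ‖S 1‖ ^ 2 = ∑ z : Lˣ, ‖S ((z : L) ^ 2)‖ ^ 2 := by
          simp only [hS]
          rw [Finset.sum_const, nsmul_eq_mul, Finset.card_univ, ← hN]
      _ = ∑ y, ∑ _z ∈ Finset.univ.filter (fun z : Lˣ => (z : L) ^ 2 = y), ‖S y‖ ^ 2 := by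
          rw [← Finset.sum_fiberwise Finset.univ (fun z : Lˣ => (z : L) ^ 2)]
          refine Finset.sum_congr rfl fun y _ => Finset.sum_congr rfl fun z hz => ?_
          rw [(Finset.mem_filter.1 hz).2]
      _ ≤ ∑ y, 2 * ‖S y‖ ^ 2 := by
          refine Finset.sum_le_sum fun y _ => ?_
          rw [Finset.sum_const, nsmul_eq_mul]
          refine mul_le_mul_of_nonneg_right ?_ (by positivity)
          exact Nat.cast_le_ofNat.2 (card_units_sq_eq_le_two _)
      _ ≤ 2 * (2 * Q * N) := by
          rw [← Finset.mul_sum]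
          linarith
  have h4 : ‖S 1‖ ^ 2 ≤ 4 * Q := by nlinarith
  have h5 : ‖S 1‖ ≤ √(4 * Q) := Real.le_sqrt_of_sq_le h4
  rw [Real.sqrt_mul (by norm_num), show (4 : ℝ) = 2 ^ 2 by norm_num,
    Real.sqrt_sq (by norm_num)] at h5
  simpa [S] using h5

/-- Nontrivial characters of `Lˣ × L` have small sums along the curve `x ↦ (x, x ^ 2)`. -/
theorem norm_sum_addChar_prod_le {L : Type*} [Field L] [Fintype L] [DecidableEq L]
    (ψ : AddChar (Additive Lˣ × L) ℂ) (hψ : ψ ≠ 1) :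
    ‖∑ x : Lˣ, ψ (Additive.ofMul x, (x : L) ^ 2)‖ ≤ 2 * √(Fintype.card L) := by
  classical
  set χ := ψ.compAddMonoidHom (AddMonoidHom.inl (Additive Lˣ) L) with hχ
  set φ := ψ.compAddMonoidHom (AddMonoidHom.inr (Additive Lˣ) L) with hφ
  have hsplit : ∀ a b, ψ (a, b) = χ a * φ b := by
    intro a b
    simp only [hχ, hφ, AddChar.compAddMonoidHom_apply, AddMonoidHom.inl_apply,
      AddMonoidHom.inr_apply, ← AddChar.map_add_eq_mul]
    simp
  simp only [hsplit]
  by_cases h : φ = 1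
  · have hχ1 : χ ≠ 0 := by
      intro h0
      apply hψ
      rw [AddChar.eq_one_iff]
      rintro ⟨a, b⟩
      rw [hsplit, h0, h]; simp
    have h0 := AddChar.sum_eq_zero_iff_ne_zero.2 hχ1
    have h1 : ∑ x : Lˣ, χ (Additive.ofMul x) = 0 := by
      rw [← h0]
      exact Fintype.sum_equiv Additive.ofMul _ _ fun _ => rfl
    simp only [h, AddChar.one_apply, mul_one, h1, norm_zero]
    positivity
  · exact norm_sum_char_sq_le χ φ h

section Frobenius

open Polynomial

variable (K L : Type*) [Field K] [Field L] [Algebra K L] [Fintype K] [Fintype L]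

/-- The Frobenius of `L` over `K` as a `K`-linear map. -/
noncomputable abbrev frobLin : Module.End K L := (FiniteField.frobeniusAlgHom K L).toLinearMap

lemma frobLin_pow_apply (i : ℕ) (x : L) :
    (frobLin K L ^ i) x = x ^ Fintype.card K ^ i := by
  induction i with
  | zero => simp
  | succ i ih =>
    rw [pow_succ', Module.End.mul_apply, ih]
    change (x ^ Fintype.card K ^ i) ^ Fintype.card K = _
    rw [← pow_mul, ← pow_succ]

/-- `X ^ n - 1` with `n = [L : K]`, the minimal polynomial of the Frobenius. -/
noncomputable abbrev frobPoly : K[X] := X ^ Module.finrank K L - 1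

lemma aeval_frobPoly : aeval (frobLin K L) (frobPoly K L) = 0 := by
  rw [frobPoly, ← FiniteField.minpoly_frobeniusAlgHom]
  exact minpoly.aeval _ _

lemma frobPoly_ne_zero : frobPoly K L ≠ 0 := by
  rw [frobPoly, ← C_1]
  exact X_pow_sub_C_ne_zero Module.finrank_pos 1

/-- The kernel of `((X ^ n - 1) / P)(Frob)`. -/
noncomputable def frobKer (P : K[X]) : Submodule K L :=
  LinearMap.ker (aeval (frobLin K L) (frobPoly K L / P))

variable {K L}

lemma aeval_mem_frobKer {P R : K[X]} (hP : P ∣ frobPoly K L) (hPR : P ∣ R) (y : L) :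
    aeval (frobLin K L) R y ∈ frobKer K L P := by
  rw [frobKer, LinearMap.mem_ker, ← Module.End.mul_apply, ← map_mul]
  obtain ⟨S, rfl⟩ := hPR
  have : frobPoly K L / P * (P * S) = frobPoly K L * S := by
    rw [← mul_assoc, mul_comm (frobPoly K L / P) P, EuclideanDomain.mul_div_cancel' _ hP]
    exact fun h => frobPoly_ne_zero K L (by simpa [h] using hP)
  rw [this, map_mul, aeval_frobPoly, zero_mul, LinearMap.zero_apply]

/-- An element outside all the `frobKer P`, `P` prime, has linearly independent conjugates. -/
theorem conjSpan_eq_top_of_forall_notMem (α : L)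
    (h : ∀ P : K[X], Irreducible P → P.Monic → P ∣ frobPoly K L → α ∉ frobKer K L P) :
    conjSpan K (Fintype.card K) (Module.finrank K L) α = ⊤ := by
  classical
  rw [conjSpan]
  refine LinearIndependent.span_eq_top_of_card_eq_finrank' ?_ (by simp)
  rw [Fintype.linearIndependent_iff]
  intro c hc
  set r : K[X] := ∑ i : Fin (Module.finrank K L), C (c i) * X ^ (i : ℕ) with hr
  have hrα : aeval (frobLin K L) r α = 0 := by
    rw [← hc, hr, map_sum, LinearMap.sum_apply]
    refine Finset.sum_congr rfl fun i _ => ?_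
    rw [map_mul, aeval_C, map_pow, aeval_X, Module.End.mul_apply, frobLin_pow_apply,
      Module.algebraMap_end_apply]
  have hdeg : r.degree < Module.finrank K L := by
    rw [hr]
    refine (degree_sum_le _ _).trans_lt ?_
    rw [Finset.sup_lt_iff (by exact_mod_cast WithBot.bot_lt_coe _)]
    intro i _
    exact (degree_C_mul_X_pow_le _ _).trans_lt (by exact_mod_cast i.2)
  have hr0 : r = 0 := by
    by_contra hne
    set g := EuclideanDomain.gcd r (frobPoly K L) with hg
    have hgα : aeval (frobLin K L) g α = 0 := by
      rw [hg, EuclideanDomain.gcd_eq_gcd_ab, mul_comm r, mul_comm (frobPoly K L), map_add, map_mul,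
        map_mul, aeval_frobPoly, LinearMap.add_apply, Module.End.mul_apply, hrα]
      simp
    have hgr : g ∣ r := EuclideanDomain.gcd_dvd_left _ _
    obtain ⟨s, hs⟩ : g ∣ frobPoly K L := EuclideanDomain.gcd_dvd_right _ _
    have hs0 : s ≠ 0 := fun h0 => frobPoly_ne_zero K L (by rw [hs, h0, mul_zero])
    have hsu : ¬ IsUnit s := by
      intro hu
      have h1 : frobPoly K L ∣ r := by
        rw [hs]; exact (hu.mul_right_dvd).2 hgr
      have h2 := degree_le_of_dvd h1 hne
      rw [frobPoly, ← C_1, degree_X_pow_sub_C Module.finrank_pos] at h2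
      exact absurd hdeg (not_lt.2 h2)
    obtain ⟨P, hPm, hPi, hPs⟩ := Polynomial.exists_monic_irreducible_factor s hsu
    obtain ⟨t, rfl⟩ := hPs
    have hP0 : P ≠ 0 := hPi.ne_zero
    have hPF : P ∣ frobPoly K L := by rw [hs]; exact ⟨g * t, by ring⟩
    refine h P hPi hPm hPF ?_
    rw [frobKer, LinearMap.mem_ker]
    have : frobPoly K L / P = t * g := by
      rw [hs, show g * (P * t) = P * (t * g) by ring, mul_div_cancel_left₀ _ hP0]
    rw [this, map_mul, Module.End.mul_apply, hgα, map_zero]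
  intro i
  have := congrArg (fun p : K[X] => p.coeff (i : ℕ)) hr0
  simp only [hr, finsetSum_coeff, coeff_C_mul, coeff_X_pow, coeff_zero] at this
  rw [Finset.sum_eq_single i] at this
  · simpa using this
  · intro j _ hj
    have : (i : ℕ) ≠ j := fun h => hj (Fin.ext h.symm)
    simp [this]
  · simp

lemma card_pow_natDegree_le_index_frobKer {P : K[X]} (hP : Irreducible P)
    (hPF : P ∣ frobPoly K L) :
    Fintype.card K ^ P.natDegree ≤ (frobKer K L P).toAddSubgroup.index := by
  classical
  set φ := aeval (frobLin K L) (frobPoly K L / P) with hφ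
  have hmul : P * (frobPoly K L / P) = frobPoly K L :=
    EuclideanDomain.mul_div_cancel' hP.ne_zero hPF
  have hφ0 : φ ≠ 0 := by
    intro h0
    have h1 := minpoly.dvd K (frobLin K L) h0
    rw [FiniteField.minpoly_frobeniusAlgHom] at h1
    obtain ⟨s, hs⟩ := h1
    apply hP.not_isUnit
    have : frobPoly K L * (P * s) = frobPoly K L * 1 := by
      calc frobPoly K L * (P * s) = P * ((X ^ Module.finrank K L - 1) * s) := by ring
        _ = frobPoly K L * 1 := by rw [← hs, hmul, mul_one]
    exact IsUnit.of_mul_eq_one _ (mul_left_cancel₀ (frobPoly_ne_zero K L) this)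
  obtain ⟨z, hz⟩ : ∃ z, φ z ≠ 0 := by
    by_contra hc
    push Not at hc
    exact hφ0 (LinearMap.ext hc)
  have hker : (frobKer K L P).toAddSubgroup = φ.toAddMonoidHom.ker := by
    ext x; simp [frobKer, hφ, AddMonoidHom.mem_ker]
  rw [hker, AddSubgroup.index_ker]
  have hcard : Fintype.card K ^ P.natDegree = Nat.card (degreeLT K P.natDegree) := by
    rw [Nat.card_congr (degreeLTEquiv K P.natDegree).toEquiv]
    simp
  rw [hcard]
  have hcomm : ∀ r : K[X], aeval (frobLin K L) r (φ z) = φ (aeval (frobLin K L) r z) := by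
    intro r
    rw [hφ, ← Module.End.mul_apply, ← map_mul, mul_comm, map_mul, Module.End.mul_apply]
  refine Nat.card_le_card_of_injective
    (fun r : degreeLT K P.natDegree =>
      (⟨φ (aeval (frobLin K L) (r : K[X]) z), ⟨_, rfl⟩⟩ : φ.toAddMonoidHom.range)) ?_
  intro r s hrs
  have h1 : φ (aeval (frobLin K L) (r : K[X]) z) = φ (aeval (frobLin K L) (s : K[X]) z) :=
    congrArg Subtype.val hrs
  rw [← hcomm, ← hcomm] at h1
  by_contra hne
  set d : K[X] := (r : K[X]) - s with hd
  have hd0 : d ≠ 0 := sub_ne_zero.2 fun h => hne (Subtype.ext h)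
  have hdd : d.degree < P.natDegree := mem_degreeLT.1 ((degreeLT K P.natDegree).sub_mem r.2 s.2)
  have hdφ : aeval (frobLin K L) d (φ z) = 0 := by
    rw [hd, map_sub, LinearMap.sub_apply, h1, sub_self]
  have hPφ : aeval (frobLin K L) P (φ z) = 0 := by
    rw [hφ, ← Module.End.mul_apply, ← map_mul, hmul, aeval_frobPoly, LinearMap.zero_apply]
  have hcop : IsCoprime P d := by
    refine (hP.coprime_iff_not_dvd).2 fun hdvd => ?_
    have := degree_le_of_dvd hdvd hd0
    rw [degree_eq_natDegree hP.ne_zero] at this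
    exact absurd hdd (not_lt.2 this)
  obtain ⟨u, v, huv⟩ := hcop
  apply hz
  have h2 : aeval (frobLin K L) (u * P + v * d) (φ z) = φ z := by rw [huv]; simp
  rw [← h2, map_add, map_mul, map_mul, LinearMap.add_apply, Module.End.mul_apply,
    Module.End.mul_apply, hPφ, hdφ]
  simp

end Frobenius

section Criterion

open Polynomial

variable (K L : Type*) [Field K] [Field L] [Algebra K L] [Fintype K] [Fintype L]

/-- The subgroups of `Lˣ × L` to be avoided by the pairs `(x, x ^ 2)`. -/
noncomputable def sieveSubgroup : ℕ ⊕ K[X] → AddSubgroup (Additive Lˣ × L)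
  | .inl l => (powMonoidHom ((Fintype.card L - 1) / l) : Lˣ →* Lˣ).ker.toAddSubgroup.comap
      (AddMonoidHom.fst (Additive Lˣ) L)
  | .inr P => (frobKer K L P).toAddSubgroup.comap (AddMonoidHom.snd (Additive Lˣ) L)

/-- The indices which are prime divisors of `|L| - 1` or of `X ^ n - 1`. -/
def IsSieveIndex : ℕ ⊕ K[X] → Prop
  | .inl l => l.Prime ∧ l ∣ Fintype.card L - 1
  | .inr P => Irreducible P ∧ P.Monic ∧ P ∣ frobPoly K L

variable {K L}

lemma mem_sieveSubgroup_inl {l : ℕ} {z : Additive Lˣ × L} :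
    z ∈ sieveSubgroup K L (.inl l) ↔ z.1.toMul ^ ((Fintype.card L - 1) / l) = 1 := Iff.rfl

lemma mem_sieveSubgroup_inr {P : K[X]} {z : Additive Lˣ × L} :
    z ∈ sieveSubgroup K L (.inr P) ↔ z.2 ∈ frobKer K L P := Iff.rfl

lemma le_index_sieveSubgroup_inl {l : ℕ} (hl : l ∣ Fintype.card L - 1) :
    l ≤ (sieveSubgroup K L (.inl l)).index := by
  classical
  obtain ⟨m, hm⟩ := hl
  have hc : 0 < Fintype.card L - 1 := by
    have := Fintype.one_lt_card (α := L); omega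
  have hl0 : 0 < l := Nat.pos_of_ne_zero fun h => by simp [h] at hm; omega
  have hm0 : 0 < m := Nat.pos_of_ne_zero fun h => by simp [h] at hm; omega
  rw [sieveSubgroup, AddSubgroup.index_comap_of_surjective _ (fun x => ⟨(x, 0), rfl⟩)]
  change l ≤ (powMonoidHom ((Fintype.card L - 1) / l) : Lˣ →* Lˣ).ker.index
  rw [hm, Nat.mul_div_cancel_left _ hl0]
  have h1 := Subgroup.card_mul_index (powMonoidHom m : Lˣ →* Lˣ).ker
  rw [Nat.card_eq_fintype_card (α := Lˣ), Fintype.card_units, hm] at h1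
  have h2 : Nat.card (powMonoidHom m : Lˣ →* Lˣ).ker ≤ m := by
    have h : (powMonoidHom m : Lˣ →* Lˣ).ker = rootsOfUnity m L := by
      ext x; simp [MonoidHom.mem_ker, mem_rootsOfUnity]
    have : NeZero m := ⟨hm0.ne'⟩
    rw [h]
    exact card_rootsOfUnity L m
  by_contra hlt
  push Not at hlt
  have : Nat.card (powMonoidHom m : Lˣ →* Lˣ).ker * (powMonoidHom m : Lˣ →* Lˣ).ker.index
      ≤ m * (powMonoidHom m : Lˣ →* Lˣ).ker.index := Nat.mul_le_mul_right _ h2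
  have h3 : m * (powMonoidHom m : Lˣ →* Lˣ).ker.index < m * l := Nat.mul_lt_mul_of_pos_left hlt hm0
  rw [mul_comm m l] at h3
  omega

lemma le_index_sieveSubgroup_inr {P : K[X]} (hP : Irreducible P) (hPF : P ∣ frobPoly K L) :
    Fintype.card K ^ P.natDegree ≤ (sieveSubgroup K L (.inr P)).index := by
  rw [sieveSubgroup, AddSubgroup.index_comap_of_surjective _ (fun x => ⟨(0, x), rfl⟩)]
  exact card_pow_natDegree_le_index_frobKer hP hPF

lemma sieveSubgroup_ne_top {i : ℕ ⊕ K[X]} (hi : IsSieveIndex K L i) : sieveSubgroup K L i ≠ ⊤ := by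
  intro h
  cases i with
  | inl l =>
    have := le_index_sieveSubgroup_inl (K := K) hi.2
    rw [h, AddSubgroup.index_top] at this
    exact absurd hi.1.two_le (by omega)
  | inr P =>
    have := le_index_sieveSubgroup_inr (L := L) hi.1 hi.2.2
    rw [h, AddSubgroup.index_top] at this
    exact absurd this (not_le.2 (Nat.one_lt_pow hi.1.natDegree_pos.ne' Fintype.one_lt_card))

lemma AddSubgroup.mem_finsetInf {ι Γ : Type*} [AddGroup Γ] (A : Finset ι) (G : ι → AddSubgroup Γ)
    (x : Γ) : x ∈ A.inf G ↔ ∀ i ∈ A, x ∈ G i := by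
  classical
  induction A using Finset.induction_on with
  | empty => simp
  | insert a s ha ih => simp [ih]

lemma sieveSubgroup_inf_sup_inf (A B : Finset (ℕ ⊕ K[X])) (hA : ∀ i ∈ A, IsSieveIndex K L i)
    (hB : ∀ i ∈ B, IsSieveIndex K L i) (hAB : Disjoint A B) :
    A.inf (sieveSubgroup K L) ⊔ B.inf (sieveSubgroup K L) = ⊤ := by
  classical
  let m : ℕ ⊕ K[X] → ℤ := Sum.elim (fun l => (l : ℤ)) (fun _ => 1)
  let g : ℕ ⊕ K[X] → K[X] := Sum.elim (fun _ => 1) id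
  have hne : ∀ i ∈ A, ∀ j ∈ B, i ≠ j := fun i hi j hj h =>
    Finset.disjoint_left.1 hAB hi (h ▸ hj)
  have hm : IsCoprime (∏ i ∈ A, m i) (∏ i ∈ B, m i) := by
    refine IsCoprime.prod_left fun i hi => IsCoprime.prod_right fun j hj => ?_
    have hij := hne i hi j hj
    have hi' := hA i hi
    have hj' := hB j hj
    rcases i with l | P <;> rcases j with l' | P' <;>
      simp only [m, Sum.elim_inl, Sum.elim_inr, isCoprime_one_left, isCoprime_one_right]
    rw [Nat.isCoprime_iff_coprime, Nat.coprime_primes hi'.1 hj'.1]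
    exact fun h => hij (by rw [h])
  have hg : IsCoprime (∏ i ∈ A, g i) (∏ i ∈ B, g i) := by
    refine IsCoprime.prod_left fun i hi => IsCoprime.prod_right fun j hj => ?_
    have hij := hne i hi j hj
    have hi' := hA i hi
    have hj' := hB j hj
    rcases i with l | P <;> rcases j with l' | P' <;>
      simp only [g, Sum.elim_inl, Sum.elim_inr, isCoprime_one_left, isCoprime_one_right, id]
    refine hi'.1.coprime_iff_not_dvd.2 fun hd => hij ?_
    rw [eq_of_monic_of_associated hi'.2.1 hj'.2.1 (hi'.1.associated_of_dvd hj'.1 hd)]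
  have key : ∀ C : Finset (ℕ ⊕ K[X]), (∀ i ∈ C, IsSieveIndex K L i) → ∀ (a : ℤ) (u : K[X])
      (z : Additive Lˣ × L), ((a * ∏ i ∈ C, m i) • z.1, aeval (frobLin K L) (u * ∏ i ∈ C, g i) z.2)
        ∈ C.inf (sieveSubgroup K L) := by
    intro C hC a u z
    rw [AddSubgroup.mem_finsetInf]
    intro i hi
    have hi' := hC i hi
    cases i with
    | inl l =>
      rw [mem_sieveSubgroup_inl]
      obtain ⟨k, hk⟩ : (l : ℤ) ∣ a * ∏ i ∈ C, m i :=
        (Finset.dvd_prod_of_mem m hi).mul_left a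
      obtain ⟨r, hr⟩ := hi'.2
      dsimp only
      rw [hk, toMul_zsmul, hr, Nat.mul_div_cancel_left _ hi'.1.pos, ← zpow_natCast, ← zpow_mul,
        show (l : ℤ) * k * r = ((l * r : ℕ) : ℤ) * k by push_cast; ring, ← hr, zpow_mul,
        zpow_natCast, ← Fintype.card_units, pow_card_eq_one, one_zpow]
    | inr P =>
      rw [mem_sieveSubgroup_inr]
      exact aeval_mem_frobKer hi'.2.2 ((Finset.dvd_prod_of_mem g hi).mul_left u) _
  obtain ⟨a, b, hab⟩ := hm
  obtain ⟨u, v, huv⟩ := hg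
  rw [eq_top_iff]
  intro z _
  rw [AddSubgroup.mem_sup]
  refine ⟨_, key A hA a u z, _, key B hB b v z, ?_⟩
  rw [Prod.mk_add_mk, ← add_zsmul, hab, ← LinearMap.add_apply, ← map_add, huv, one_zsmul, map_one]
  rfl

/-- The sieve criterion: `S, T` split the primes dividing `(|L| - 1) / 2`, and `U, V` the monic
irreducible factors of `X ^ n - 1`. -/
theorem exists_of_sieve_bound (hodd : Odd (Fintype.card L)) (S T : Finset ℕ) (U V : Finset K[X])
    (hST : Disjoint S T) (hUV : Disjoint U V)
    (hM : ∀ l, l ∈ S ∨ l ∈ T ↔ l.Prime ∧ l ∣ (Fintype.card L - 1) / 2)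
    (hF : ∀ P : K[X], P ∈ U ∨ P ∈ V ↔ Irreducible P ∧ P.Monic ∧ P ∣ frobPoly K L)
    (δ : ℝ) (hδ0 : 0 < δ) (hδ : δ ≤ 1 - ∑ l ∈ T, (l : ℝ)⁻¹
      - ∑ P ∈ V, ((Fintype.card K : ℝ) ^ P.natDegree)⁻¹)
    (hlt : 2 ^ (S.card + U.card) * (2 * δ + ((T.card + V.card - 1 : ℕ) : ℝ))
      * (2 * √(Fintype.card L)) < δ * ((Fintype.card L - 1 : ℕ) : ℝ)) :
    ∃ α : L, orderOf α = (Fintype.card L - 1) / 2 ∧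
      conjSpan K (Fintype.card K) (Module.finrank K L) α = ⊤ := by
  classical
  have hcard := Fintype.one_lt_card (α := L)
  obtain ⟨M, hMeq⟩ := hodd
  have hM1 : Fintype.card L - 1 = 2 * M := by omega
  have hM2 : (Fintype.card L - 1) / 2 = M := by omega
  have hM0 : 0 < M := by omega
  rw [hM2] at hM ⊢
  have hidx : ∀ i, i ∈ S.disjSum U ∨ i ∈ T.disjSum V → IsSieveIndex K L i := by
    intro i hi
    cases i with
    | inl l =>
      simp only [Finset.inl_mem_disjSum] at hi
      obtain ⟨h1, h2⟩ := (hM l).1 hi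
      exact ⟨h1, hM1 ▸ h2.mul_left 2⟩
    | inr P =>
      simp only [Finset.inr_mem_disjSum] at hi
      exact (hF P).1 hi
  set δ' : ℝ := 1 - ∑ i ∈ T.disjSum V, ((sieveSubgroup K L i).index : ℝ)⁻¹ with hδ'
  have hle : δ ≤ δ' := by
    refine hδ.trans ?_
    rw [hδ', Finset.sum_disjSum, sub_sub]
    refine sub_le_sub_left (add_le_add (Finset.sum_le_sum fun l hl => ?_)
      (Finset.sum_le_sum fun P hP => ?_)) 1
    · obtain ⟨h1, h2⟩ := (hM l).1 (Or.inr hl)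
      refine inv_anti₀ (by exact_mod_cast h1.pos) ?_
      exact_mod_cast le_index_sieveSubgroup_inl (hM1 ▸ h2.mul_left 2)
    · obtain ⟨h1, _, h2⟩ := (hF P).1 (Or.inr hP)
      refine inv_anti₀ (pow_pos (by exact_mod_cast Fintype.card_pos) _) ?_
      exact_mod_cast le_index_sieveSubgroup_inr h1 h2
  have hE : (0 : ℝ) ≤ 2 * √(Fintype.card L) := by positivity
  obtain ⟨x, hx⟩ := exists_avoiding (sieveSubgroup K L)
    (fun x : Lˣ => (Additive.ofMul x, (x : L) ^ 2)) hE
    (fun ψ hψ => norm_sum_addChar_prod_le ψ hψ) (S.disjSum U) (T.disjSum V)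
    (Finset.disjoint_left.2 fun i h1 h2 => by
      cases i with
      | inl l =>
        exact Finset.disjoint_left.1 hST (Finset.inl_mem_disjSum.1 h1) (Finset.inl_mem_disjSum.1 h2)
      | inr P =>
        exact Finset.disjoint_left.1 hUV (Finset.inr_mem_disjSum.1 h1) (Finset.inr_mem_disjSum.1 h2))
    (fun i hi => sieveSubgroup_ne_top (hidx i (Or.inl hi)))
    (fun A B hA hB hAB => sieveSubgroup_inf_sup_inf A B (fun i hi => hidx i (hA i hi))
      (fun i hi => hidx i (hB i hi)) hAB) δ' hδ' (hδ0.le.trans hle) (by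
      rw [Finset.card_disjSum, Finset.card_disjSum, Fintype.card_units]
      set N : ℝ := ((Fintype.card L - 1 : ℕ) : ℝ)
      set c : ℝ := 2 ^ (S.card + U.card)
      set E : ℝ := 2 * √(Fintype.card L)
      have hc : 0 ≤ c * E := by positivity
      set k : ℕ := T.card + V.card
      have hk : (k : ℝ) - 1 ≤ ((k - 1 : ℕ) : ℝ) := by
        rw [sub_le_iff_le_add]; exact_mod_cast (by omega : k ≤ k - 1 + 1)
      have hk0 : (0 : ℝ) ≤ ((k - 1 : ℕ) : ℝ) := by positivity
      have h1 : 0 < δ * (N - 2 * (c * E)) := by nlinarith [mul_nonneg hc hk0]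
      have h2 : 0 < N - 2 * (c * E) := (pos_iff_pos_of_mul_pos h1).1 hδ0
      have h3 := mul_le_mul_of_nonneg_left hk hc
      nlinarith [mul_le_mul_of_nonneg_right hle h2.le])
  refine ⟨(x : L) ^ 2, ?_, ?_⟩
  · refine orderOf_eq_of_pow_and_pow_div_prime hM0 ?_ fun l hl hlM => ?_
    · rw [← pow_mul, ← hM1, ← Units.val_pow_eq_pow_val, ← Fintype.card_units, pow_card_eq_one,
        Units.val_one]
    · intro h
      have hmem : l ∈ S ∨ l ∈ T := (hM l).2 ⟨hl, hlM⟩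
      refine hx (.inl l) (by simpa using hmem) ?_
      rw [mem_sieveSubgroup_inl, hM1, Nat.mul_div_assoc _ hlM]
      ext
      rw [← pow_mul] at h
      simpa using h
  · refine conjSpan_eq_top_of_forall_notMem _ fun P h1 h2 h3 => ?_
    have hmem : P ∈ U ∨ P ∈ V := (hF P).2 ⟨h1, h2, h3⟩
    exact hx (.inr P) (by simpa using hmem)

end Criterion

section FactorCount

open Polynomial Finset

variable (K L : Type*) [Field K] [Field L] [Algebra K L] [Fintype K] [Fintype L]

open Classical in
/-- The monic irreducible factors of `X ^ n - 1`. -/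
noncomputable def frobFactors : Finset K[X] :=
  (UniqueFactorizationMonoid.normalizedFactors (frobPoly K L)).toFinset

variable {K L}

lemma mem_frobFactors {P : K[X]} :
    P ∈ frobFactors K L ↔ Irreducible P ∧ P.Monic ∧ P ∣ frobPoly K L := by
  classical
  rw [frobFactors, Multiset.mem_toFinset,
    Polynomial.mem_normalizedFactors_iff (frobPoly_ne_zero K L)]

lemma pairwise_isCoprime_frobFactors :
    ((frobFactors K L : Finset K[X]) : Set K[X]).Pairwise (Function.onFun IsCoprime id) := by
  intro P hP R hR hne
  rw [Finset.mem_coe, mem_frobFactors] at hP hR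
  refine hP.1.coprime_iff_not_dvd.2 fun hd => hne ?_
  exact eq_of_monic_of_associated hP.2.1 hR.2.1 (hP.1.associated_of_dvd hR.1 hd)

lemma sum_natDegree_le_of_dvd {s : Finset K[X]} (hs : s ⊆ frobFactors K L) {m : ℕ} (hm : 0 < m)
    (h : ∀ P ∈ s, P ∣ X ^ m - 1) : ∑ P ∈ s, P.natDegree ≤ m := by
  have hdvd : ∏ P ∈ s, P ∣ X ^ m - 1 :=
    Finset.prod_dvd_of_coprime (fun P hP R hR => pairwise_isCoprime_frobFactors (hs hP) (hs hR)) h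
  have h0 : (X ^ m - 1 : K[X]) ≠ 0 := by
    rw [← C_1]; exact X_pow_sub_C_ne_zero hm 1
  have := natDegree_le_of_dvd hdvd h0
  rw [natDegree_prod_of_monic _ _ fun P hP => (mem_frobFactors.1 (hs hP)).2.1] at this
  rwa [← C_1, natDegree_X_pow_sub_C] at this

lemma sum_natDegree_frobFactors_le : ∑ P ∈ frobFactors K L, P.natDegree ≤ Module.finrank K L :=
  sum_natDegree_le_of_dvd subset_rfl Module.finrank_pos fun _ hP => (mem_frobFactors.1 hP).2.2

lemma natDegree_pos_of_mem_frobFactors {P : K[X]} (hP : P ∈ frobFactors K L) :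
    0 < P.natDegree :=
  (mem_frobFactors.1 hP).1.natDegree_pos

lemma natDegree_le_of_mem_frobFactors {P : K[X]} (hP : P ∈ frobFactors K L) :
    P.natDegree ≤ Module.finrank K L := by
  have h := natDegree_le_of_dvd (mem_frobFactors.1 hP).2.2 (frobPoly_ne_zero K L)
  rwa [frobPoly, ← C_1, natDegree_X_pow_sub_C] at h

lemma dvd_X_pow_gcd_sub_one {P : K[X]} (hP : P ∈ frobFactors K L) {d : ℕ}
    (hd : P.natDegree ∣ d) :
    P ∣ X ^ Nat.gcd (Module.finrank K L) (Fintype.card K ^ d - 1) - 1 := by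
  obtain ⟨hi, -, hF⟩ := mem_frobFactors.1 hP
  have key : ∀ m : ℕ, P ∣ X ^ m - 1 ↔ AdjoinRoot.root P ^ m = 1 := by
    intro m
    rw [← AdjoinRoot.mk_eq_zero, map_sub, map_pow, AdjoinRoot.mk_X, map_one, sub_eq_zero]
  rw [key, ← orderOf_dvd_iff_pow_eq_one]
  refine Nat.dvd_gcd (orderOf_dvd_of_pow_eq_one ((key _).1 hF)) (orderOf_dvd_of_pow_eq_one ?_)
  rw [← key]
  have h1 := (hi.natDegree_dvd_iff_dvd_X_pow_card_pow_sub_X (n := d)).1 hd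
  rw [Nat.card_eq_fintype_card] at h1
  have hq : 0 < Fintype.card K ^ d := pow_pos Fintype.card_pos d
  have h2 : (X ^ Fintype.card K ^ d - X : K[X]) = X * (X ^ (Fintype.card K ^ d - 1) - 1) := by
    rw [mul_sub, mul_one, ← pow_succ', Nat.sub_add_cancel hq]
  rw [h2] at h1
  refine (hi.prime.dvd_or_dvd h1).resolve_left fun hX => hi.not_isUnit ?_
  have h3 : P ∣ (X : K[X]) ^ Module.finrank K L := hX.trans (dvd_pow_self _ Module.finrank_pos.ne')
  have h4 := dvd_sub h3 hF
  rw [frobPoly, sub_sub_cancel] at h4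
  exact isUnit_of_dvd_one h4

open Classical in
lemma sum_natDegree_filter_dvd_le (d : ℕ) :
    ∑ P ∈ frobFactors K L with P.natDegree ∣ d, P.natDegree
      ≤ Nat.gcd (Module.finrank K L) (Fintype.card K ^ d - 1) :=
  sum_natDegree_le_of_dvd (Finset.filter_subset _ _)
    (Nat.gcd_pos_of_pos_left _ Module.finrank_pos) fun _ hP =>
      dvd_X_pow_gcd_sub_one (Finset.mem_filter.1 hP).1 (Finset.mem_filter.1 hP).2

lemma card_filter_natDegree_one_le :
    #{P ∈ frobFactors K L | P.natDegree = 1}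
      ≤ Nat.gcd (Module.finrank K L) (Fintype.card K - 1) := by
  classical
  have h := sum_natDegree_filter_dvd_le (K := K) (L := L) 1
  simp only [Nat.dvd_one, pow_one] at h
  rw [Finset.card_eq_sum_ones]
  refine le_trans (le_of_eq (Finset.sum_congr rfl fun P hP => ?_)) h
  exact (Finset.mem_filter.1 hP).2.symm

lemma le_card_filter_natDegree_one :
    Nat.gcd (Module.finrank K L) (Fintype.card K - 1)
      ≤ #{P ∈ frobFactors K L | P.natDegree = 1} := by
  classical
  set g := Nat.gcd (Module.finrank K L) (Fintype.card K - 1) with hg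
  have hg0 : 0 < g := Nat.gcd_pos_of_pos_left _ Module.finrank_pos
  obtain ⟨u, hu⟩ := IsCyclic.exists_ofOrder_eq_natCard (α := Kˣ)
  rw [Nat.card_eq_fintype_card, Fintype.card_units] at hu
  obtain ⟨m, hm⟩ : g ∣ Fintype.card K - 1 := Nat.gcd_dvd_right _ _
  have hq : 0 < Fintype.card K - 1 := by
    have := Fintype.one_lt_card (α := K); omega
  have hζ : IsPrimitiveRoot (u ^ m) g :=
    (hu ▸ IsPrimitiveRoot.orderOf u).pow hq (by rw [hm, mul_comm])
  have hinj : Set.InjOn (fun i : ℕ => (X - C (((u ^ m) ^ i : Kˣ) : K) : K[X]))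
      (Finset.range g : Set ℕ) := by
    intro i hi j hj hij
    have h1 : (((u ^ m) ^ i : Kˣ) : K) = ((u ^ m) ^ j : Kˣ) := C_injective (sub_right_injective hij)
    exact hζ.pow_inj (by simpa using hi) (by simpa using hj) (Units.ext h1)
  conv_lhs => rw [← Finset.card_range g]
  refine Finset.card_le_card_of_injOn _ ?_ hinj
  intro i _
  rw [Finset.mem_coe, Finset.mem_filter, mem_frobFactors]
  refine ⟨⟨irreducible_X_sub_C _, monic_X_sub_C _, ?_⟩, natDegree_X_sub_C _⟩
  rw [dvd_iff_isRoot]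
  have h1 : ((u ^ m) ^ i) ^ Module.finrank K L = 1 := by
    obtain ⟨k, hk⟩ : g ∣ Module.finrank K L := Nat.gcd_dvd_left _ _
    rw [hk, ← pow_mul, mul_left_comm, pow_mul, hζ.pow_eq_one, one_pow]
  simp only [IsRoot.def, eval_sub, eval_pow, eval_X, eval_one]
  rw [← Units.val_pow_eq_pow_val, h1, Units.val_one, sub_self]

/-- An upper bound for the number of irreducible factors of degree `d` of `X ^ n - 1` over the field
with `q` elements. -/
def factorBound (q n d : ℕ) : ℕ :=
  if d = 1 then Nat.gcd n (q - 1) else (Nat.gcd n (q ^ d - 1) - Nat.gcd n (q - 1)) / d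

lemma card_filter_natDegree_eq_le {d : ℕ} (hd : 0 < d) :
    #{P ∈ frobFactors K L | P.natDegree = d}
      ≤ factorBound (Fintype.card K) (Module.finrank K L) d := by
  classical
  unfold factorBound
  split_ifs with h1
  · rw [h1]; exact card_filter_natDegree_one_le
  rw [Nat.le_div_iff_mul_le hd]
  refine Nat.le_sub_of_add_le (le_trans ?_ (sum_natDegree_filter_dvd_le (K := K) (L := L) d))
  refine le_trans (Nat.add_le_add_left le_card_filter_natDegree_one _) ?_
  have h2 : ∀ e : ℕ, #{P ∈ frobFactors K L | P.natDegree = e} * e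
      = ∑ P ∈ frobFactors K L with P.natDegree = e, P.natDegree := by
    intro e
    rw [← smul_eq_mul, ← Finset.sum_const]
    exact Finset.sum_congr rfl fun P hP => (Finset.mem_filter.1 hP).2.symm
  have h3 := h2 1
  rw [mul_one] at h3
  rw [h2 d, h3, ← Finset.sum_union]
  · refine Finset.sum_le_sum_of_subset fun P hP => ?_
    rw [Finset.mem_union, Finset.mem_filter, Finset.mem_filter] at hP
    rw [Finset.mem_filter]
    rcases hP with ⟨h, h'⟩ | ⟨h, h'⟩
    · exact ⟨h, h'.dvd⟩
    · exact ⟨h, h' ▸ one_dvd _⟩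
  · rw [Finset.disjoint_filter]
    exact fun P _ h h' => h1 (h.symm.trans h')

lemma two_mul_card_frobFactors_le :
    2 * #(frobFactors K L) ≤ Module.finrank K L
      + Nat.gcd (Module.finrank K L) (Fintype.card K - 1) := by
  classical
  refine le_trans ?_ (add_le_add sum_natDegree_frobFactors_le
    (card_filter_natDegree_one_le (K := K) (L := L)))
  rw [Finset.card_filter, ← Finset.sum_add_distrib, mul_comm, ← smul_eq_mul, ← Finset.sum_const]
  refine Finset.sum_le_sum fun P hP => ?_
  have := natDegree_pos_of_mem_frobFactors hP
  split_ifs <;> omega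

lemma three_mul_card_frobFactors_le :
    3 * #(frobFactors K L) ≤ Module.finrank K L
      + 2 * factorBound (Fintype.card K) (Module.finrank K L) 1
      + factorBound (Fintype.card K) (Module.finrank K L) 2 := by
  classical
  refine le_trans ?_ (add_le_add (add_le_add sum_natDegree_frobFactors_le
    (Nat.mul_le_mul_left 2 (card_filter_natDegree_eq_le (K := K) (L := L) one_pos)))
    (card_filter_natDegree_eq_le (K := K) (L := L) two_pos))
  rw [Finset.card_filter, Finset.card_filter, Finset.mul_sum, ← Finset.sum_add_distrib,
    ← Finset.sum_add_distrib, mul_comm, ← smul_eq_mul, ← Finset.sum_const]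
  refine Finset.sum_le_sum fun P hP => ?_
  have := natDegree_pos_of_mem_frobFactors hP
  split_ifs <;> omega

lemma card_frobFactors_le : #(frobFactors K L) ≤ Module.finrank K L := by
  refine le_trans ?_ (sum_natDegree_frobFactors_le (K := K) (L := L))
  rw [Finset.card_eq_sum_ones]
  exact Finset.sum_le_sum fun P hP => natDegree_pos_of_mem_frobFactors hP

end FactorCount

section LargeCases

open Polynomial Finset

lemma Finset.sixteen_pow_card_mul_le_of_prime (s : Finset ℕ) (hs : ∀ p ∈ s, p.Prime) :
    16 ^ #s * 30030 ≤ 16 ^ 6 * ∏ p ∈ s, p := by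
  have hlarge : 16 ^ #(s \ {2, 3, 5, 7, 11, 13}) ≤ ∏ p ∈ s \ {2, 3, 5, 7, 11, 13}, p := by
    rw [← Finset.prod_const]
    refine Finset.prod_le_prod' fun p hp => ?_
    rw [Finset.mem_sdiff] at hp
    by_contra hlt
    have hp' := hs p hp.1
    push Not at hlt
    interval_cases p <;> first | exact hp.2 (by decide) | exact absurd hp' (by decide)
  have hsmall : ∀ t ∈ ({2, 3, 5, 7, 11, 13} : Finset ℕ).powerset,
      16 ^ #t * 30030 ≤ 16 ^ 6 * ∏ p ∈ t, p := by decide +kernel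
  have h1 := hsmall (s ∩ {2, 3, 5, 7, 11, 13}) (Finset.mem_powerset.2 Finset.inter_subset_right)
  rw [← Finset.card_inter_add_card_sdiff s {2, 3, 5, 7, 11, 13},
    ← Finset.prod_inter_mul_prod_sdiff s {2, 3, 5, 7, 11, 13} (fun p => p), pow_add]
  calc _ = 16 ^ #(s ∩ {2, 3, 5, 7, 11, 13}) * 30030 * 16 ^ #(s \ {2, 3, 5, 7, 11, 13}) := by ring
    _ ≤ _ := Nat.mul_le_mul h1 hlarge
    _ = _ := by ring

lemma Nat.two_pow_card_primeFactors_pow_four_le {m : ℕ} (hm : m ≠ 0) :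
    (2 ^ #m.primeFactors) ^ 4 ≤ 559 * m := by
  have h1 := Finset.sixteen_pow_card_mul_le_of_prime m.primeFactors fun p =>
    Nat.prime_of_mem_primeFactors
  have h2 := Nat.le_of_dvd (Nat.pos_of_ne_zero hm) (Nat.prod_primeFactors_dvd m)
  rw [← pow_mul, mul_comm, pow_mul]
  norm_num at h1 ⊢
  omega

variable {K L : Type*} [Field K] [Field L] [Algebra K L] [Fintype K] [Fintype L]

/-- The criterion with all prime divisors of `(|L| - 1) / 2` in the core. -/
theorem exists_of_factor_split (hodd : Odd (Fintype.card L)) (hbig : 27 ≤ Fintype.card L)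
    (U V : Finset K[X]) (hUV : Disjoint U V)
    (hF : ∀ P : K[X], P ∈ U ∨ P ∈ V ↔ P ∈ frobFactors K L)
    (δ : ℝ) (hδ0 : 0 < δ) (hδ : δ ≤ 1 - ∑ P ∈ V, ((Fintype.card K : ℝ) ^ P.natDegree)⁻¹)
    (c : ℝ) (hc : 2 ^ #U * (2 * δ + ((#V - 1 : ℕ) : ℝ)) ≤ c * δ)
    (hlt : 6000 * c ^ 4 ≤ Fintype.card L) :
    ∃ α : L, orderOf α = (Fintype.card L - 1) / 2 ∧
      conjSpan K (Fintype.card K) (Module.finrank K L) α = ⊤ := by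
  classical
  set Q := Fintype.card L with hQ
  have hM0 : (Q - 1) / 2 ≠ 0 := by omega
  refine exists_of_sieve_bound (K := K) hodd ((Q - 1) / 2).primeFactors ∅ U V
    (Finset.disjoint_empty_right _) hUV (fun l => ?_) (fun P => by rw [hF, mem_frobFactors]) δ hδ0
    (by simpa using hδ) ?_
  · rw [Nat.mem_primeFactors]
    exact ⟨fun h => h.elim (fun h => ⟨h.1, h.2.1⟩) (fun h => absurd h (Finset.notMem_empty l)),
      fun h => Or.inl ⟨h.1, h.2, hM0⟩⟩
  set w : ℝ := 2 ^ #((Q - 1) / 2).primeFactors with hw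
  have hw0 : 0 < w := by positivity
  have hw4 : 2 * w ^ 4 ≤ 559 * Q := by
    have h := Nat.two_pow_card_primeFactors_pow_four_le hM0
    have h' : 2 * (2 ^ #((Q - 1) / 2).primeFactors) ^ 4 ≤ 559 * Q := by omega
    rw [hw]
    exact_mod_cast h'
  have hQ27 : (27 : ℝ) ≤ Q := by exact_mod_cast hbig
  have hc0 : 0 < c := by
    have : 0 < 2 ^ #U * (2 * δ + ((#V - 1 : ℕ) : ℝ)) := by positivity
    exact (pos_iff_pos_of_mul_pos (this.trans_le hc)).2 hδ0
  have hcast : ((Q - 1 : ℕ) : ℝ) = Q - 1 := by rw [Nat.cast_sub (by omega)]; simp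
  have hmain : w * c * (2 * √Q) < Q - 1 := by
    have hsq : √(Q : ℝ) ^ 4 = (Q : ℝ) ^ 2 := by
      rw [show 4 = 2 * 2 by norm_num, pow_mul, Real.sq_sqrt (by positivity)]
    refine lt_of_pow_lt_pow_left₀ 4 (by linarith) ?_
    have h1 : (w * c * (2 * √(Q : ℝ))) ^ 4 = 16 * w ^ 4 * c ^ 4 * (Q : ℝ) ^ 2 := by
      rw [← hsq]; ring
    rw [h1]
    have h2 : 6000 * (16 * w ^ 4 * c ^ 4 * (Q : ℝ) ^ 2) ≤ 4472 * (Q : ℝ) ^ 4 := by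
      have h3 : (2 * w ^ 4) * (6000 * c ^ 4) ≤ (559 * Q) * Q :=
        mul_le_mul hw4 hlt (by positivity) (by positivity)
      nlinarith [mul_le_mul_of_nonneg_right h3 (by positivity : (0 : ℝ) ≤ 8 * (Q : ℝ) ^ 2)]
    have h4 : (26 / 27 * (Q : ℝ)) ^ 4 ≤ ((Q : ℝ) - 1) ^ 4 :=
      pow_le_pow_left₀ (by positivity) (by linarith) 4
    rw [mul_pow] at h4
    have h5 : (0 : ℝ) < (Q : ℝ) ^ 4 := by positivity
    have h6 : (4472 / 6000 : ℝ) < (26 / 27) ^ 4 := by norm_num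
    nlinarith [mul_lt_mul_of_pos_right h6 h5]
  rw [hcast, Finset.card_empty, zero_add, pow_add]
  calc w * 2 ^ #U * (2 * δ + ((#V - 1 : ℕ) : ℝ)) * (2 * √Q)
      = w * (2 * √Q) * (2 ^ #U * (2 * δ + ((#V - 1 : ℕ) : ℝ))) := by ring
    _ ≤ w * (2 * √Q) * (c * δ) := mul_le_mul_of_nonneg_left hc (by positivity)
    _ = δ * (w * c * (2 * √Q)) := by ring
    _ < δ * (Q - 1) := mul_lt_mul_of_pos_left hmain hδ0

/-- No factor of `X ^ n - 1` is sieved. -/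
theorem exists_of_card_factors (hodd : Odd (Fintype.card L)) (hbig : 27 ≤ Fintype.card L)
    (hlt : 100000 * 16 ^ #(frobFactors K L) ≤ Fintype.card L) :
    ∃ α : L, orderOf α = (Fintype.card L - 1) / 2 ∧
      conjSpan K (Fintype.card K) (Module.finrank K L) α = ⊤ := by
  refine exists_of_factor_split hodd hbig (frobFactors K L) ∅ (Finset.disjoint_empty_right _)
    (fun P => by simp) 1 one_pos (by simp) (2 * 2 ^ #(frobFactors K L)) (by simp [mul_comm]) ?_
  have h : (100000 * 16 ^ #(frobFactors K L) : ℝ) ≤ Fintype.card L := by exact_mod_cast hlt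
  refine le_trans (le_of_eq_of_le ?_ (mul_le_mul_of_nonneg_right
    (by norm_num : (96000 : ℝ) ≤ 100000) (by positivity : (0 : ℝ) ≤ 16 ^ #(frobFactors K L)))) h
  rw [mul_pow, ← pow_mul, mul_comm _ 4, pow_mul]
  norm_num
  ring

/-- All factors of `X ^ n - 1` are sieved. -/
theorem exists_of_finrank_lt (hodd : Odd (Fintype.card L)) (hbig : 27 ≤ Fintype.card L)
    (hn : Module.finrank K L < Fintype.card K) (c : ℝ)
    (hc : 2 * ((Fintype.card K : ℝ) - Module.finrank K L)
      + Fintype.card K * (Module.finrank K L - 1)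
      ≤ c * (Fintype.card K - Module.finrank K L))
    (hlt : 6000 * c ^ 4 ≤ Fintype.card L) :
    ∃ α : L, orderOf α = (Fintype.card L - 1) / 2 ∧
      conjSpan K (Fintype.card K) (Module.finrank K L) α = ⊤ := by
  set q := Fintype.card K
  set n := Module.finrank K L
  have hq0 : (0 : ℝ) < q := by exact_mod_cast (Nat.zero_le n).trans_lt hn
  have hnq : (n : ℝ) < q := by exact_mod_cast hn
  have hn0 : 0 < n := Module.finrank_pos
  refine exists_of_factor_split hodd hbig ∅ (frobFactors K L) (Finset.disjoint_empty_left _)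
    (fun P => by simp) (1 - n / q) (by rw [sub_pos, div_lt_one hq0]; exact hnq) ?_ c ?_ hlt
  · refine sub_le_sub_left ?_ 1
    calc ∑ P ∈ frobFactors K L, ((q : ℝ) ^ P.natDegree)⁻¹
        ≤ ∑ P ∈ frobFactors K L, (q : ℝ)⁻¹ := by
          refine Finset.sum_le_sum fun P hP => inv_anti₀ hq0 ?_
          refine le_self_pow₀ ?_ (natDegree_pos_of_mem_frobFactors hP).ne'
          exact_mod_cast Fintype.card_pos
      _ = #(frobFactors K L) * (q : ℝ)⁻¹ := by rw [Finset.sum_const, nsmul_eq_mul]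
      _ ≤ n / q := by
          rw [div_eq_mul_inv]
          exact mul_le_mul_of_nonneg_right (by exact_mod_cast card_frobFactors_le) (by positivity)
  · have h1 : ((#(frobFactors K L) - 1 : ℕ) : ℝ) ≤ n - 1 := by
      rw [le_sub_iff_add_le]
      have := card_frobFactors_le (K := K) (L := L)
      exact_mod_cast (by omega : #(frobFactors K L) - 1 + 1 ≤ n)
    rw [Finset.card_empty, pow_zero, one_mul]
    have h2 : (1 - n / q : ℝ) = (q - n) / q := by field_simp
    rw [h2]
    calc 2 * (((q : ℝ) - n) / q) + ((#(frobFactors K L) - 1 : ℕ) : ℝ)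
        ≤ 2 * (((q : ℝ) - n) / q) + (n - 1) := by linarith
      _ = (2 * ((q : ℝ) - n) + q * (n - 1)) / q := by field_simp
      _ ≤ (c * (q - n)) / q := div_le_div_of_nonneg_right hc hq0.le
      _ = c * ((q - n) / q) := by ring

end LargeCases

section LargeCases

open Polynomial Finset

lemma Nat.mul_pow_le_pow_of_le {A a b m n : ℕ} (hab : a ≤ b) (hm : A * a ^ m ≤ b ^ m)
    (hmn : m ≤ n) : A * a ^ n ≤ b ^ n := by
  obtain ⟨k, rfl⟩ := Nat.exists_eq_add_of_le hmn
  rw [pow_add, pow_add, ← mul_assoc]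
  exact Nat.mul_le_mul hm (Nat.pow_le_pow_left hab k)

lemma odd_card_of_odd {L : Type*} [Fintype L] {q n : ℕ} (hL : Fintype.card L = q ^ n) (hq : Odd q) :
    Odd (Fintype.card L) := hL ▸ hq.pow

lemma twentySeven_le_card {L : Type*} [Fintype L] {q n : ℕ} (hL : Fintype.card L = q ^ n)
    (hq : 3 ≤ q) (hn : 3 ≤ n) :
    27 ≤ Fintype.card L := by
  rw [hL]
  exact (Nat.pow_le_pow_left hq 3).trans (Nat.pow_le_pow_right (by omega) hn)

variable {K L : Type*} [Field K] [Field L] [Algebra K L] [Fintype K] [Fintype L]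

theorem exists_of_sq_bound {q n m : ℕ} (hodd : Odd q) (hq : 5 ≤ q) (hn : 3 ≤ n)
    (hK : Fintype.card K = q) (hL : Fintype.card L = q ^ n) (hr : Module.finrank K L = n)
    (hm : 10 ^ 10 * 16 ^ (q - 1) * 16 ^ m ≤ (q ^ 2) ^ m) (hmn : m ≤ n) :
    ∃ α : L, orderOf α = (Fintype.card L - 1) / 2 ∧
      conjSpan K (Fintype.card K) (Module.finrank K L) α = ⊤ := by
  refine exists_of_card_factors (odd_card_of_odd hL hodd) (twentySeven_le_card hL (by omega) hn) ?_
  rw [hL]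
  have h2 := two_mul_card_frobFactors_le (K := K) (L := L)
  rw [hr, hK] at h2
  have hg := Nat.gcd_le_right n (show 0 < q - 1 by omega)
  refine le_of_pow_le_pow_left₀ two_ne_zero (Nat.zero_le _) ?_
  calc (100000 * 16 ^ #(frobFactors K L)) ^ 2 = 10 ^ 10 * 16 ^ (2 * #(frobFactors K L)) := by
        rw [mul_pow, ← pow_mul, mul_comm 2]; norm_num
    _ ≤ 10 ^ 10 * 16 ^ ((q - 1) + n) :=
        Nat.mul_le_mul_left _ (Nat.pow_le_pow_right (by norm_num) (by omega))
    _ = 10 ^ 10 * 16 ^ (q - 1) * 16 ^ n := by rw [pow_add, mul_assoc]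
    _ ≤ (q ^ 2) ^ n := Nat.mul_pow_le_pow_of_le (by nlinarith) hm hmn
    _ = (q ^ n) ^ 2 := by rw [← pow_mul, ← pow_mul, mul_comm]

theorem exists_of_card_eq_three {n : ℕ} (hn : 104 ≤ n)
    (hK : Fintype.card K = 3) (hL : Fintype.card L = 3 ^ n) (hr : Module.finrank K L = n) :
    ∃ α : L, orderOf α = (Fintype.card L - 1) / 2 ∧
      conjSpan K (Fintype.card K) (Module.finrank K L) α = ⊤ := by
  refine exists_of_card_factors (odd_card_of_odd hL (by decide))
    (twentySeven_le_card hL le_rfl (by omega)) ?_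
  rw [hL]
  have h2 := three_mul_card_frobFactors_le (K := K) (L := L)
  rw [hr, hK] at h2
  have hg1 : Nat.gcd n 2 ≤ 2 := Nat.gcd_le_right n two_pos
  have hg1' : 0 < Nat.gcd n 2 := Nat.gcd_pos_of_pos_right n two_pos
  have hg2 : Nat.gcd n 8 ≤ 8 := Nat.gcd_le_right n (by norm_num)
  norm_num [factorBound] at h2
  refine le_of_pow_le_pow_left₀ three_ne_zero (Nat.zero_le _) ?_
  calc (100000 * 16 ^ #(frobFactors K L)) ^ 3 = 10 ^ 15 * 16 ^ (3 * #(frobFactors K L)) := by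
        rw [mul_pow, ← pow_mul, mul_comm 3]; norm_num
    _ ≤ 10 ^ 15 * 16 ^ (7 + n) :=
        Nat.mul_le_mul_left _ (Nat.pow_le_pow_right (by norm_num) (by omega))
    _ = 10 ^ 15 * 16 ^ 7 * 16 ^ n := by rw [pow_add, mul_assoc]
    _ ≤ 27 ^ n := Nat.mul_pow_le_pow_of_le (by norm_num) (by norm_num) hn
    _ = (3 ^ n) ^ 3 := by rw [← pow_mul, mul_comm, pow_mul]; norm_num

theorem exists_of_seventeen_le_card_le_finrank {q n : ℕ} (hodd : Odd q) (hq : 17 ≤ q) (hn : q ≤ n)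
    (hK : Fintype.card K = q) (hL : Fintype.card L = q ^ n) (hr : Module.finrank K L = n) :
    ∃ α : L, orderOf α = (Fintype.card L - 1) / 2 ∧
      conjSpan K (Fintype.card K) (Module.finrank K L) α = ⊤ := by
  refine exists_of_card_factors (odd_card_of_odd hL hodd)
    (twentySeven_le_card hL (by omega) (by omega)) ?_
  rw [hL]
  have h2 := two_mul_card_frobFactors_le (K := K) (L := L)
  rw [hr, hK] at h2
  have hg := Nat.gcd_le_right n (show 0 < q - 1 by omega)
  obtain ⟨k, hk⟩ := Nat.gcd_dvd_left n (q - 1)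
  have hk2 : 2 ≤ k := by
    by_contra hlt
    have : Nat.gcd n (q - 1) * k ≤ Nat.gcd n (q - 1) * 1 := Nat.mul_le_mul_left _ (by omega)
    omega
  have h3 : Nat.gcd n (q - 1) * 2 ≤ n := by
    conv_rhs => rw [hk]
    exact Nat.mul_le_mul_left _ hk2
  calc 100000 * 16 ^ #(frobFactors K L) = 100000 * 2 ^ (4 * #(frobFactors K L)) := by
        rw [pow_mul]; norm_num
    _ ≤ 100000 * 2 ^ (3 * n) :=
        Nat.mul_le_mul_left _ (Nat.pow_le_pow_right (by norm_num) (by omega))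
    _ = 100000 * 8 ^ n := by rw [pow_mul]; norm_num
    _ ≤ 17 ^ n := Nat.mul_pow_le_pow_of_le (by norm_num) (by norm_num : _ ≤ 17 ^ 17) (hq.trans hn)
    _ ≤ q ^ n := Nat.pow_le_pow_left hq n

theorem exists_of_finrank_lt_of_const {q n m : ℕ} (hodd : Odd q) (hq : 17 ≤ q) (hn : 3 ≤ n)
    (hnq : n < q) (hK : Fintype.card K = q) (hL : Fintype.card L = q ^ n)
    (hr : Module.finrank K L = n) (c : ℝ) (hmq : m ≤ q)
    (hc : 2 * ((q : ℝ) - n) + q * (n - 1) ≤ c * (q - n)) (hlt : 6000 * c ^ 4 ≤ (m : ℝ) ^ n) :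
    ∃ α : L, orderOf α = (Fintype.card L - 1) / 2 ∧
      conjSpan K (Fintype.card K) (Module.finrank K L) α = ⊤ := by
  refine exists_of_finrank_lt (odd_card_of_odd hL hodd) (twentySeven_le_card hL (by omega) hn)
    (by rw [hr, hK]; exact hnq) c (by rw [hr, hK]; exact hc) ?_
  rw [hL]
  push_cast
  exact hlt.trans (pow_le_pow_left₀ (by positivity) (by exact_mod_cast hmq) n)

theorem exists_of_finrank_lt_card {q n : ℕ} (hodd : Odd q) (hq : 17 ≤ q) (hn : 3 ≤ n)
    (hnq : n < q) (h3 : n = 3 → 127 < q) (h4 : n = 4 → 49 < q) (h5 : n = 5 → 31 < q)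
    (h6 : n = 6 → 19 < q) (hK : Fintype.card K = q) (hL : Fintype.card L = q ^ n)
    (hr : Module.finrank K L = n) :
    ∃ α : L, orderOf α = (Fintype.card L - 1) / 2 ∧
      conjSpan K (Fintype.card K) (Module.finrank K L) α = ⊤ := by
  have hq' : (17 : ℝ) ≤ q := by exact_mod_cast hq
  have hnq' : (n : ℝ) + 1 ≤ q := by exact_mod_cast hnq
  have hn' : (3 : ℝ) ≤ n := by exact_mod_cast hn
  have key : ∀ (m : ℕ) (c : ℝ), m ≤ q →
      2 * ((q : ℝ) - n) + q * (n - 1) ≤ c * (q - n) → 6000 * c ^ 4 ≤ (m : ℝ) ^ n → _ :=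
    fun m c => exists_of_finrank_lt_of_const (m := m) hodd hq hn hnq hK hL hr c
  rcases lt_or_ge n 12 with hlt | hge
  · interval_cases n
    · have hm : 128 ≤ q := h3 rfl
      exact key 128 (41 / 10) hm (by
        have : (128 : ℝ) ≤ q := by exact_mod_cast hm
        push_cast; linarith) (by norm_num)
    · have hm : 50 ≤ q := h4 rfl
      exact key 50 (11 / 2) hm (by
        have : (50 : ℝ) ≤ q := by exact_mod_cast hm
        push_cast; linarith) (by norm_num)
    · have hm : 32 ≤ q := h5 rfl
      exact key 32 7 hm (by
        have : (32 : ℝ) ≤ q := by exact_mod_cast hm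
        push_cast; linarith) (by norm_num)
    · have hm : 21 ≤ q := by
        have := h6 rfl
        rcases hodd with ⟨k, hk⟩
        omega
      exact key 21 9 hm (by
        have : (21 : ℝ) ≤ q := by exact_mod_cast hm
        push_cast; linarith) (by norm_num)
    · exact key 17 13 hq (by push_cast; linarith) (by norm_num)
    · exact key 17 16 hq (by push_cast; linarith) (by norm_num)
    · exact key 17 19 hq (by push_cast; linarith) (by norm_num)
    · exact key 17 24 hq (by push_cast; linarith) (by norm_num)
    · exact key 17 31 hq (by push_cast; linarith) (by norm_num)
  · refine key q ((q : ℝ) ^ 2) le_rfl ?_ ?_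
    · nlinarith [mul_nonneg (by linarith : (0 : ℝ) ≤ (q : ℝ) - n - 1) (sq_nonneg (q : ℝ)),
        mul_nonneg (by linarith : (0 : ℝ) ≤ (q : ℝ) - n - 1) (by linarith : (0 : ℝ) ≤ (q : ℝ))]
    · obtain ⟨k, rfl⟩ := Nat.exists_eq_add_of_le hge
      calc 6000 * ((q : ℝ) ^ 2) ^ 4 ≤ (q : ℝ) ^ 4 * ((q : ℝ) ^ 2) ^ 4 := by
            refine mul_le_mul_of_nonneg_right ?_ (by positivity)
            exact le_trans (by norm_num) (pow_le_pow_left₀ (by norm_num) hq' 4)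
        _ = (q : ℝ) ^ 12 := by ring
        _ ≤ (q : ℝ) ^ (12 + k) := pow_le_pow_right₀ (by linarith) (by omega)

end LargeCases

section FiniteCheck

open Polynomial Finset

/-- The primes below `128`. -/
def smallPrimes : Finset ℕ :=
  {2, 3, 5, 7, 11, 13, 17, 19, 23, 29, 31, 37, 41, 43, 47, 53, 59, 61, 67, 71, 73, 79, 83, 89, 97,
    101, 103, 107, 109, 113, 127}

lemma mem_smallPrimes_of_lt {p : ℕ} (hp : p.Prime) (h : p < 128) : p ∈ smallPrimes := by
  have key : ∀ p < 128, p.Prime → p ∈ smallPrimes := by decide +kernel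
  exact key p h hp

/-- An upper bound for the number of prime divisors of `m` that are at least `128`. -/
def largePrimeBound (m : ℕ) : ℕ :=
  Nat.log2 (m / Nat.gcd m ((∏ p ∈ smallPrimes, p) ^ 200)) / 7

lemma card_filter_le_largePrimeBound {m : ℕ} (hm : m ≠ 0) :
    #{p ∈ m.primeFactors | 128 ≤ p} ≤ largePrimeBound m := by
  set T := {p ∈ m.primeFactors | 128 ≤ p} with hT
  set g := Nat.gcd m ((∏ p ∈ smallPrimes, p) ^ 200) with hg
  have hg0 : 0 < g := Nat.gcd_pos_of_pos_left _ (Nat.pos_of_ne_zero hm)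
  have hTm : ∏ p ∈ T, p ∣ m :=
    (Finset.prod_dvd_prod_of_subset _ _ _ (Finset.filter_subset _ _)).trans
      (Nat.prod_primeFactors_dvd m)
  have hcop : Nat.Coprime (∏ p ∈ T, p) g := by
    refine Nat.Coprime.coprime_dvd_right (Nat.gcd_dvd_right _ _) ?_
    refine Nat.Coprime.pow_right _ ?_
    refine Nat.Coprime.prod_left fun p hp => Nat.Coprime.prod_right fun r hr => ?_
    rw [hT, Finset.mem_filter] at hp
    have hrp : ∀ r ∈ smallPrimes, r.Prime ∧ r < 128 := by decide +kernel
    obtain ⟨hr, hr'⟩ := hrp r hr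
    rw [Nat.coprime_primes (Nat.prime_of_mem_primeFactors hp.1) hr]
    omega
  have hmul : (∏ p ∈ T, p) * g ∣ m := hcop.mul_dvd_of_dvd_of_dvd hTm (Nat.gcd_dvd_left _ _)
  have hle : ∏ p ∈ T, p ≤ m / g := by
    rw [Nat.le_div_iff_mul_le hg0]
    exact Nat.le_of_dvd (Nat.pos_of_ne_zero hm) hmul
  have hpow : 2 ^ (7 * #T) ≤ m / g := by
    refine le_trans ?_ hle
    rw [pow_mul, ← Finset.prod_const]
    exact Finset.prod_le_prod' fun p hp => (Finset.mem_filter.1 hp).2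
  have h0 : m / g ≠ 0 := (lt_of_lt_of_le (by positivity) hpow).ne'
  rw [largePrimeBound, Nat.le_div_iff_mul_le (by norm_num), Nat.le_log2 h0, mul_comm]
  exact hpow

/-- The number of sieving primes and factors, where the primes below `s` and the factors of degree
at most `D` are excluded. -/
def sieveCount (q n s D : ℕ) : ℕ :=
  #{p ∈ smallPrimes | p ∣ (q ^ n - 1) / 2 ∧ s ≤ p} + largePrimeBound ((q ^ n - 1) / 2)
    + ∑ d ∈ Ioc D n, factorBound q n d

/-- An upper bound for `10 ^ 6` times the sum of the densities removed by the sieve. -/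
def sieveWeight (q n s D : ℕ) : ℕ :=
  ∑ p ∈ smallPrimes with p ∣ (q ^ n - 1) / 2 ∧ s ≤ p, (10 ^ 6 / p + 1)
    + largePrimeBound ((q ^ n - 1) / 2) * (10 ^ 6 / 128 + 1)
    + ∑ d ∈ Ioc D n, factorBound q n d * (10 ^ 6 / q ^ d + 1)

/-- The size of the part that is not sieved. -/
def sieveCore (q n s D : ℕ) : ℕ :=
  #{p ∈ smallPrimes | p ∣ (q ^ n - 1) / 2 ∧ p < s} + ∑ d ∈ Ioc 0 D, factorBound q n d

/-- The sieve inequality in integer form. -/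
def SieveCheck (q n s D : ℕ) : Prop :=
  sieveWeight q n s D < 10 ^ 6 ∧
    (2 ^ sieveCore q n s D * (2 * (10 ^ 6 - sieveWeight q n s D)
      + 10 ^ 6 * (sieveCount q n s D - 1)) * 2) ^ 2 * q ^ n
      < ((10 ^ 6 - sieveWeight q n s D) * (q ^ n - 1)) ^ 2

instance (q n s D : ℕ) : Decidable (SieveCheck q n s D) :=
  inferInstanceAs (Decidable (_ ∧ _))

lemma inv_le_div_add_one_div {N a : ℕ} (hN : 0 < N) (ha : 0 < a) :
    (a : ℝ)⁻¹ ≤ ((N / a + 1 : ℕ) : ℝ) / N := by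
  have hN' : (0 : ℝ) < N := by exact_mod_cast hN
  have ha' : (0 : ℝ) < a := by exact_mod_cast ha
  rw [le_div_iff₀ hN', inv_mul_le_iff₀ ha']
  exact_mod_cast (Nat.lt_mul_div_succ N ha).le

variable {K L : Type*} [Field K] [Field L] [Algebra K L] [Fintype K] [Fintype L]

lemma sum_filter_frobFactors_le {R : Type*} [Semiring R] [PartialOrder R] [IsOrderedRing R]
    (A : Finset ℕ) (hA : ∀ d ∈ A, 0 < d) (w : ℕ → R) (hw : ∀ d, 0 ≤ w d) :
    ∑ P ∈ frobFactors K L with P.natDegree ∈ A, w P.natDegree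
      ≤ ∑ d ∈ A, (factorBound (Fintype.card K) (Module.finrank K L) d : R) * w d := by
  rw [← Finset.sum_fiberwise_of_maps_to (g := Polynomial.natDegree) (t := A)
    (fun P hP => (Finset.mem_filter.1 hP).2)]
  refine Finset.sum_le_sum fun d hd => ?_
  rw [Finset.sum_congr rfl fun P hP => by rw [(Finset.mem_filter.1 hP).2], Finset.sum_const,
    nsmul_eq_mul]
  refine mul_le_mul_of_nonneg_right (Nat.mono_cast ?_) (hw d)
  refine (Finset.card_le_card ?_).trans (card_filter_natDegree_eq_le (L := L) (hA d hd))
  intro P hP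
  simp only [Finset.mem_filter] at hP ⊢
  exact ⟨hP.1.1, hP.2⟩

lemma card_filter_frobFactors_le (A : Finset ℕ) (hA : ∀ d ∈ A, 0 < d) :
    #{P ∈ frobFactors K L | P.natDegree ∈ A}
      ≤ ∑ d ∈ A, factorBound (Fintype.card K) (Module.finrank K L) d := by
  simpa using sum_filter_frobFactors_le (K := K) (L := L) A hA (fun _ => (1 : ℕ)) (by simp)

theorem exists_of_sieveCheck {q n s D : ℕ} (hodd : Odd q) (hq : 3 ≤ q) (hn : 3 ≤ n)
    (hs : s ≤ 128) (hK : Fintype.card K = q) (hL : Fintype.card L = q ^ n)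
    (hr : Module.finrank K L = n) (hc : SieveCheck q n s D) :
    ∃ α : L, orderOf α = (Fintype.card L - 1) / 2 ∧
      conjSpan K (Fintype.card K) (Module.finrank K L) α = ⊤ := by
  classical
  have hbig := twentySeven_le_card hL hq hn
  set M := (q ^ n - 1) / 2 with hM
  have hM0 : M ≠ 0 := by rw [hL] at hbig; omega
  set S := {p ∈ M.primeFactors | p < s} with hS
  set T := {p ∈ M.primeFactors | s ≤ p} with hT
  set U := {P ∈ frobFactors K L | P.natDegree ∈ Ioc 0 D} with hU
  set V := {P ∈ frobFactors K L | P.natDegree ∈ Ioc D n} with hV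
  set T₁ := {p ∈ smallPrimes | p ∣ M ∧ s ≤ p} with hT₁
  set T₂ := {p ∈ M.primeFactors | 128 ≤ p} with hT₂
  have hTsub : T ⊆ T₁ ∪ T₂ := by
    intro p hp
    rw [hT, Finset.mem_filter, Nat.mem_primeFactors] at hp
    rw [Finset.mem_union, hT₁, hT₂, Finset.mem_filter, Finset.mem_filter, Nat.mem_primeFactors]
    rcases lt_or_ge p 128 with h | h
    · exact Or.inl ⟨mem_smallPrimes_of_lt hp.1.1 h, hp.1.2.1, hp.2⟩
    · exact Or.inr ⟨hp.1, h⟩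
  have hT₂card : #T₂ ≤ largePrimeBound M := card_filter_le_largePrimeBound hM0
  have hcore : #S + #U ≤ sieveCore q n s D := by
    refine add_le_add (Finset.card_le_card fun p hp => ?_) ?_
    · rw [hS, Finset.mem_filter, Nat.mem_primeFactors] at hp
      rw [Finset.mem_filter]
      exact ⟨mem_smallPrimes_of_lt hp.1.1 (hp.2.trans_le hs), hp.1.2.1, hp.2⟩
    · have := card_filter_frobFactors_le (K := K) (L := L) (Ioc 0 D) (by simp +contextual)
      rwa [hK, hr] at this
  have hcount : #T + #V ≤ sieveCount q n s D := by
    refine add_le_add ?_ ?_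
    · exact (Finset.card_le_card hTsub).trans ((Finset.card_union_le _ _).trans
        (add_le_add le_rfl hT₂card))
    · have := card_filter_frobFactors_le (K := K) (L := L) (Ioc D n)
        (fun d hd => (Nat.zero_le D).trans_lt (Finset.mem_Ioc.1 hd).1)
      rwa [hK, hr] at this
  have hsumT : ∑ l ∈ T, (l : ℝ)⁻¹ ≤ ((∑ p ∈ T₁, (10 ^ 6 / p + 1)
      + largePrimeBound M * (10 ^ 6 / 128 + 1) : ℕ) : ℝ) / (10 ^ 6 : ℕ) := by
    have hpos : ∀ p ∈ T₁ ∪ T₂, 0 < p := fun p hp => by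
      rcases Finset.mem_union.1 hp with h | h
      · refine Nat.pos_of_dvd_of_pos (Finset.mem_filter.1 h).2.1 (Nat.pos_of_ne_zero hM0)
      · exact lt_of_lt_of_le (by norm_num) (Finset.mem_filter.1 h).2
    calc ∑ l ∈ T, (l : ℝ)⁻¹ ≤ ∑ l ∈ T₁ ∪ T₂, (l : ℝ)⁻¹ :=
          Finset.sum_le_sum_of_subset_of_nonneg hTsub fun _ _ _ => by positivity
      _ ≤ ∑ l ∈ T₁, (l : ℝ)⁻¹ + ∑ l ∈ T₂, (l : ℝ)⁻¹ := by
          rw [← Finset.sum_union_inter]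
          exact le_add_of_nonneg_right (Finset.sum_nonneg fun _ _ => by positivity)
      _ ≤ ∑ p ∈ T₁, ((10 ^ 6 / p + 1 : ℕ) : ℝ) / (10 ^ 6 : ℕ)
          + ∑ p ∈ T₂, ((10 ^ 6 / 128 + 1 : ℕ) : ℝ) / (10 ^ 6 : ℕ) := by
          refine add_le_add (Finset.sum_le_sum fun p hp => ?_) (Finset.sum_le_sum fun p hp => ?_)
          · exact inv_le_div_add_one_div (by norm_num) (hpos p (Finset.mem_union_left _ hp))
          · refine le_trans ?_ (inv_le_div_add_one_div (N := 10 ^ 6) (a := 128) (by norm_num)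
              (by norm_num))
            refine inv_anti₀ (by norm_num) ?_
            exact_mod_cast (Finset.mem_filter.1 hp).2
      _ ≤ _ := by
          rw [← Finset.sum_div, ← Finset.sum_div, ← add_div, Finset.sum_const, nsmul_eq_mul]
          refine div_le_div_of_nonneg_right ?_ (by positivity)
          exact_mod_cast Nat.add_le_add_left (Nat.mul_le_mul_right _ hT₂card) _
  have hsumV : ∑ P ∈ V, ((q : ℝ) ^ P.natDegree)⁻¹
      ≤ ((∑ d ∈ Ioc D n, factorBound q n d * (10 ^ 6 / q ^ d + 1) : ℕ) : ℝ) / (10 ^ 6 : ℕ) := by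
    have h := sum_filter_frobFactors_le (K := K) (L := L) (Ioc D n)
      (fun d hd => (Nat.zero_le D).trans_lt (Finset.mem_Ioc.1 hd).1)
      (fun d => ((q : ℝ) ^ d)⁻¹) (fun d => by positivity)
    rw [hK, hr] at h
    refine h.trans ?_
    rw [Nat.cast_sum, Finset.sum_div]
    refine Finset.sum_le_sum fun d _ => ?_
    rw [Nat.cast_mul, mul_div_assoc]
    refine mul_le_mul_of_nonneg_left ?_ (Nat.cast_nonneg _)
    have := inv_le_div_add_one_div (N := 10 ^ 6) (a := q ^ d) (by norm_num) (by positivity)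
    rwa [Nat.cast_pow q d] at this
  obtain ⟨hW, hlt⟩ := hc
  set Δ := 10 ^ 6 - sieveWeight q n s D with hΔ
  have hΔ0 : 0 < Δ := Nat.sub_pos_of_lt hW
  have hΔ' : (Δ : ℝ) / (10 ^ 6 : ℕ) = 1 - (sieveWeight q n s D : ℝ) / (10 ^ 6 : ℕ) := by
    rw [hΔ, Nat.cast_sub hW.le, sub_div, div_self (by norm_num)]
  refine exists_of_sieve_bound (K := K) (odd_card_of_odd hL hodd) S T U V ?_ ?_ ?_ ?_
    ((Δ : ℝ) / (10 ^ 6 : ℕ)) (by positivity) ?_ ?_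
  · exact Finset.disjoint_filter.2 fun p _ h => by omega
  · exact Finset.disjoint_filter.2 fun P _ h h' => by rw [Finset.mem_Ioc] at h h'; omega
  · intro l
    rw [hL, hS, hT, Finset.mem_filter, Finset.mem_filter, Nat.mem_primeFactors, ← and_or_left]
    exact ⟨fun h => ⟨h.1.1, h.1.2.1⟩, fun h => ⟨⟨h.1, h.2, hM0⟩, lt_or_ge l s⟩⟩
  · intro P
    rw [← mem_frobFactors, hU, hV, Finset.mem_filter, Finset.mem_filter, ← and_or_left,
      and_iff_left_iff_imp]
    intro hP
    have h1 := natDegree_pos_of_mem_frobFactors hP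
    have h2 := natDegree_le_of_mem_frobFactors hP
    rw [Finset.mem_Ioc, Finset.mem_Ioc]
    omega
  · rw [hK, hΔ', sub_sub]
    refine sub_le_sub_left ((add_le_add hsumT hsumV).trans ?_) _
    rw [← add_div, ← Nat.cast_add]
    exact le_rfl
  · have hcast : ((10 ^ 6 : ℕ) : ℝ) = 10 ^ 6 := by norm_num
    rw [hL]
    calc 2 ^ (#S + #U) * (2 * ((Δ : ℝ) / (10 ^ 6 : ℕ)) + ((#T + #V - 1 : ℕ) : ℝ))
          * (2 * √((q ^ n : ℕ) : ℝ))
        ≤ 2 ^ sieveCore q n s D * (2 * ((Δ : ℝ) / (10 ^ 6 : ℕ))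
          + ((sieveCount q n s D - 1 : ℕ) : ℝ)) * (2 * √((q ^ n : ℕ) : ℝ)) := by
          gcongr
          · norm_num
      _ = ((2 ^ sieveCore q n s D * (2 * Δ + 10 ^ 6 * (sieveCount q n s D - 1)) * 2 : ℕ) : ℝ)
          * √((q ^ n : ℕ) : ℝ) / (10 ^ 6 : ℕ) := by
          push_cast
          field_simp
      _ < ((Δ * (q ^ n - 1) : ℕ) : ℝ) / (10 ^ 6 : ℕ) := by
          refine div_lt_div_of_pos_right ?_ (by norm_num)
          refine lt_of_pow_lt_pow_left₀ 2 (by positivity) ?_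
          rw [mul_pow, Real.sq_sqrt (by positivity)]
          exact_mod_cast hlt
      _ = _ := by rw [Nat.cast_mul, div_mul_eq_mul_div]

/-- One of four choices of the sieving parameters succeeds. -/
def SieveCheckAny (q n : ℕ) : Prop :=
  SieveCheck q n 6 1 ∨ SieveCheck q n 3 0 ∨ SieveCheck q n 6 0 ∨ SieveCheck q n 3 1

instance (q n : ℕ) : Decidable (SieveCheckAny q n) :=
  inferInstanceAs (Decidable (_ ∨ _))

theorem exists_of_sieveCheckAny {q n : ℕ} (hodd : Odd q) (hq : 3 ≤ q) (hn : 3 ≤ n)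
    (hK : Fintype.card K = q) (hL : Fintype.card L = q ^ n)
    (hr : Module.finrank K L = n) (hc : SieveCheckAny q n) :
    ∃ α : L, orderOf α = (Fintype.card L - 1) / 2 ∧
      conjSpan K (Fintype.card K) (Module.finrank K L) α = ⊤ := by
  rcases hc with h | h | h | h <;>
    exact exists_of_sieveCheck hodd hq hn (by norm_num) hK hL hr h

lemma sieveCheckAny_three : ∀ n < 104, 3 ≤ n → n ∉ ({3, 4, 6, 8} : Finset ℕ) →
    SieveCheckAny 3 n := by
  decide +kernel

lemma sieveCheckAny_five : ∀ n < 77, 3 ≤ n → n ∉ ({3, 4, 6, 8} : Finset ℕ) →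
    SieveCheckAny 5 n := by
  decide +kernel

lemma sieveCheckAny_seven : ∀ n < 36, 3 ≤ n → n ∉ ({3, 4, 6} : Finset ℕ) →
    SieveCheckAny 7 n := by
  decide +kernel

lemma sieveCheckAny_nine : ∀ n < 28, 3 ≤ n → SieveCheckAny 9 n := by
  decide +kernel

lemma sieveCheckAny_eleven : ∀ n < 26, 3 ≤ n → SieveCheckAny 11 n := by
  decide +kernel

lemma sieveCheckAny_thirteen : ∀ n < 24, 3 ≤ n → n ≠ 4 → SieveCheckAny 13 n := by
  decide +kernel

lemma sieveCheckAny_of_seventeen_le :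
    (∀ q < 128, 17 ≤ q → q % 2 = 1 → SieveCheckAny q 3) ∧
    (∀ q < 50, 17 ≤ q → q % 2 = 1 → SieveCheckAny q 4) ∧
    (∀ q < 32, 17 ≤ q → q % 2 = 1 → SieveCheckAny q 5) ∧
    (∀ q < 20, 17 ≤ q → q % 2 = 1 → SieveCheckAny q 6) := by
  decide +kernel

end FiniteCheck

section ListArithmetic

/-- The value at `a` of the polynomial with coefficient list `l`. -/
def evalList {A : Type*} [CommRing A] (a : A) : List ℕ → A
  | [] => 0
  | c :: l => c + a * evalList a l

/-- Addition of coefficient lists modulo `p`. -/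
def addList (p : ℕ) : List ℕ → List ℕ → List ℕ
  | [], m => m
  | c :: l, [] => c :: l
  | c :: l, d :: m => (c + d) % p :: addList p l m

/-- Multiplication of a coefficient list by a scalar modulo `p`. -/
def smulList (p c : ℕ) (l : List ℕ) : List ℕ :=
  l.map fun d => c * d % p

/-- Multiplication by the variable, subject to the relation `X ^ g.length = g`. -/
def mulVarList (p : ℕ) (g l : List ℕ) : List ℕ :=
  match l.drop (g.length - 1) with
  | [c] => addList p (0 :: l.take (g.length - 1)) (smulList p c g)
  | _ => 0 :: l

/-- Multiplication of coefficient lists, subject to the relation `X ^ g.length = g`. -/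
def mulList (p : ℕ) (g : List ℕ) : List ℕ → List ℕ → List ℕ
  | [], _ => []
  | c :: l, m => addList p (smulList p c m) (mulVarList p g (mulList p g l m))

/-- Powers of coefficient lists by repeated squaring, with `f` bounding the recursion depth. -/
def powListAux (p : ℕ) (g l : List ℕ) : ℕ → ℕ → List ℕ
  | 0, _ => [1]
  | f + 1, e =>
    if e = 0 then [1] else
      let h := powListAux p g l f (e / 2)
      let s := mulList p g h h
      if e % 2 = 1 then mulList p g l s else s

/-- Powers of coefficient lists by repeated squaring. -/
def powList (p : ℕ) (g l : List ℕ) (e : ℕ) : List ℕ :=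
  powListAux p g l e e

/-- The sum of the first `k` Frobenius conjugates. -/
def traceList (p : ℕ) (g : List ℕ) : ℕ → List ℕ → List ℕ
  | 0, _ => []
  | k + 1, l => addList p l (traceList p g k (powList p g l p))

/-- The `k`-th iterate of the Frobenius. -/
def conjList (p : ℕ) (g : List ℕ) : ℕ → List ℕ → List ℕ
  | 0, l => l
  | k + 1, l => conjList p g k (powList p g l p)

/-- The coefficient list represents the constant `c`. -/
def IsConstList (c : ℕ) (l : List ℕ) : Prop :=
  l.headD 0 = c ∧ ∀ d ∈ l.tail, d = 0

instance (c : ℕ) (l : List ℕ) : Decidable (IsConstList c l) :=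
  inferInstanceAs (Decidable (_ ∧ _))

lemma IsConstList.evalList_eq {A : Type*} [CommRing A] {a : A} {c : ℕ} {l : List ℕ}
    (h : IsConstList c l) :
    evalList a l = c := by
  have hz : ∀ l : List ℕ, (∀ d ∈ l, d = 0) → evalList a l = 0 := by
    intro l hl
    induction l with
    | nil => rfl
    | cons d l ih =>
      rw [evalList, hl d List.mem_cons_self, ih fun x hx => hl x (List.mem_cons_of_mem d hx)]
      simp
  obtain ⟨h1, h2⟩ := h
  cases l with
  | nil => simp [evalList, ← h1]
  | cons d l =>
    rw [evalList, hz l h2, ← h1]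
    simp

variable {A : Type*} [CommRing A] {p : ℕ} [CharP A p] {a : A} {g : List ℕ}

variable (p) in
lemma natCast_mod_self (c : ℕ) : ((c % p : ℕ) : A) = c := by
  rw [CharP.natCast_eq_natCast A p, Nat.ModEq, Nat.mod_mod]

lemma evalList_addList (l m : List ℕ) :
    evalList a (addList p l m) = evalList a l + evalList a m := by
  induction l generalizing m with
  | nil => simp [addList, evalList]
  | cons c l ih =>
    cases m with
    | nil => simp [addList, evalList]
    | cons d m =>
      rw [addList, evalList, evalList, evalList, ih, natCast_mod_self p, Nat.cast_add]
      ring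

lemma evalList_smulList (c : ℕ) (l : List ℕ) :
    evalList a (smulList p c l) = c * evalList a l := by
  induction l with
  | nil => simp [smulList, evalList]
  | cons d l ih =>
    rw [smulList, List.map_cons, ← smulList, evalList, evalList, ih, natCast_mod_self p,
      Nat.cast_mul]
    ring

lemma evalList_append (l m : List ℕ) :
    evalList a (l ++ m) = evalList a l + a ^ l.length * evalList a m := by
  induction l with
  | nil => simp [evalList]
  | cons c l ih =>
    rw [List.cons_append, evalList, evalList, ih, List.length_cons]
    ring

lemma evalList_mulVarList (hg0 : g ≠ []) (hg : a ^ g.length = evalList a g) (l : List ℕ) :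
    evalList a (mulVarList p g l) = a * evalList a l := by
  rw [mulVarList]
  split
  · rename_i c hc
    have hlen : (l.take (g.length - 1)).length = g.length - 1 := by
      have := congrArg List.length hc
      rw [List.length_drop, List.length_singleton] at this
      rw [List.length_take]
      omega
    have hl : evalList a l = evalList a (l.take (g.length - 1)) + a ^ (g.length - 1) * c := by
      conv_lhs => rw [← List.take_append_drop (g.length - 1) l, evalList_append, hlen, hc]
      simp [evalList]
    have hpos : 0 < g.length := List.length_pos_iff.2 hg0
    have hpow : a ^ g.length = a * a ^ (g.length - 1) := by
      rw [← pow_succ', Nat.sub_add_cancel hpos]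
    rw [evalList_addList, evalList_smulList, evalList, hl, ← hg, hpow]
    push_cast
    ring
  · simp [evalList]

lemma evalList_mulList (hg0 : g ≠ []) (hg : a ^ g.length = evalList a g) (l m : List ℕ) :
    evalList a (mulList p g l m) = evalList a l * evalList a m := by
  induction l with
  | nil => simp [mulList, evalList]
  | cons c l ih =>
    rw [mulList, evalList_addList, evalList_smulList, evalList_mulVarList hg0 hg, ih, evalList]
    ring

lemma evalList_powList (hg0 : g ≠ []) (hg : a ^ g.length = evalList a g) (l : List ℕ) (e : ℕ) :
    evalList a (powList p g l e) = evalList a l ^ e := by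
  have key : ∀ f e : ℕ, e < 2 ^ f → evalList a (powListAux p g l f e) = evalList a l ^ e := by
    intro f
    induction f with
    | zero =>
      intro e he
      obtain rfl : e = 0 := by omega
      simp [powListAux, evalList]
    | succ f ih =>
      intro e he
      rw [powListAux]
      split_ifs with h0 h1
      · simp [h0, evalList]
      · rw [evalList_mulList hg0 hg, evalList_mulList hg0 hg, ih _ (by omega), ← pow_add,
          ← pow_succ']
        congr 1
        omega
      · rw [evalList_mulList hg0 hg, ih _ (by omega), ← pow_add]
        congr 1
        omega
  exact key e e Nat.lt_two_pow_self

lemma evalList_traceList (hg0 : g ≠ []) (hg : a ^ g.length = evalList a g) (k : ℕ)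
    (l : List ℕ) :
    evalList a (traceList p g k l) = ∑ i ∈ Finset.range k, evalList a l ^ p ^ i := by
  induction k generalizing l with
  | zero => simp [traceList, evalList]
  | succ k ih =>
    rw [traceList, evalList_addList, ih, evalList_powList hg0 hg, Finset.sum_range_succ', pow_zero,
      pow_one, add_comm]
    simp_rw [← pow_mul, ← pow_succ']

lemma evalList_conjList (hg0 : g ≠ []) (hg : a ^ g.length = evalList a g) (k : ℕ)
    (l : List ℕ) :
    evalList a (conjList p g k l) = evalList a l ^ p ^ k := by
  induction k generalizing l with
  | zero => simp [conjList]
  | succ k ih => rw [conjList, ih, evalList_powList hg0 hg, ← pow_mul, ← pow_succ']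

end ListArithmetic

section ExplicitElements

open Polynomial

/-- A certificate that a root of `X ^ g.length = g` over `F_p` has order `(p ^ n - 1) / 2` and is
normal, with dual basis generated by the element `b`. -/
def NormalRootCheck (p : ℕ) (g b ps : List ℕ) : Prop :=
  (∀ l ∈ ps, l.Prime) ∧
  (p ^ g.length - 1) / 2 ∣ ps.prod ^ 10 ∧
  IsConstList 1 (powList p g [0, 1] ((p ^ g.length - 1) / 2)) ∧
  (∀ l ∈ ps, IsConstList 1 (powList p g
    (addList p [p - 1] (powList p g [0, 1] ((p ^ g.length - 1) / 2 / l))) (p ^ g.length - 1))) ∧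
  ∀ m < 2 * g.length, IsConstList (if m % g.length = 0 then 1 else 0)
    (traceList p g g.length (mulList p g b (conjList p g m [0, 1])))

instance (p : ℕ) (g b ps : List ℕ) : Decidable (NormalRootCheck p g b ps) :=
  inferInstanceAs (Decidable (_ ∧ _))

lemma exists_pow_length_eq_evalList {L : Type*} [Field L] [Fintype L] {p : ℕ} [CharP L p]
    {g : List ℕ} (hg0 : g ≠ []) (hL : Fintype.card L = p ^ g.length) {m : ℕ}
    (hm : m ∣ p ^ g.length - 1) (hone : IsConstList 1 (powList p g [0, 1] m)) :
    ∃ a : L, a ^ g.length = evalList a g := by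
  have hlen : 0 < g.length := List.length_pos_iff.2 hg0
  have hdeg : ∀ l : List ℕ, (evalList (X : L[X]) l).degree < l.length := by
    intro l
    induction l with
    | nil => simp [evalList]
    | cons c l ih =>
      rw [evalList, List.length_cons]
      refine (degree_add_le _ _).trans_lt (max_lt ?_ ?_)
      · exact (degree_natCast_le c).trans_lt (by exact_mod_cast Nat.succ_pos _)
      · rw [X_mul, degree_mul_X, Nat.cast_add, Nat.cast_one]
        exact WithBot.add_lt_add_right (by simp) ih
  set f : L[X] := X ^ g.length - evalList X g with hf
  have hfdeg : f.degree = g.length := by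
    rw [hf, degree_sub_eq_left_of_degree_lt (by simpa using hdeg g), degree_X_pow]
  have hf1 : f.degree ≠ 0 := by rw [hfdeg]; exact_mod_cast hlen.ne'
  have hmap : ∀ {B : Type _} [CommRing B] (φ : L[X] →+* B) (l : List ℕ),
      φ (evalList X l) = evalList (φ X) l := by
    intro B _ φ l
    induction l with
    | nil => simp [evalList]
    | cons c l ih => simp [evalList, ih]
  have : Nontrivial (AdjoinRoot f) := AdjoinRoot.nontrivial f hf1
  have : CharP (AdjoinRoot f) p := charP_of_injective_algebraMap
    (algebraMap L (AdjoinRoot f)).injective p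
  have hroot : AdjoinRoot.root f ^ g.length = evalList (AdjoinRoot.root f) g := by
    have h := AdjoinRoot.mk_self (f := f)
    rw [hf, map_sub, map_pow, hmap] at h
    exact sub_eq_zero.1 h
  have hpow : AdjoinRoot.root f ^ m = 1 := by
    have h := hone.evalList_eq (a := AdjoinRoot.root f)
    rw [evalList_powList hg0 hroot] at h
    simpa [evalList] using h
  have hcard : AdjoinRoot.root f ^ Fintype.card L = AdjoinRoot.root f := by
    obtain ⟨k, hk⟩ := hm
    have hpos : 0 < p ^ g.length := hL ▸ Fintype.card_pos
    rw [hL, ← Nat.sub_add_cancel hpos, pow_succ, hk, pow_mul, hpow, one_pow, one_mul]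
  have hdvd : f ∣ X ^ Fintype.card L - X := by
    rw [← AdjoinRoot.mk_eq_zero, map_sub, map_pow, AdjoinRoot.mk_X, hcard, sub_self]
  have hsplit : (X ^ Fintype.card L - X : L[X]).Splits := by
    rw [splits_iff_card_roots, FiniteField.roots_X_pow_card_sub_X,
      FiniteField.X_pow_card_sub_X_natDegree_eq L Fintype.one_lt_card, Finset.card_val,
      Finset.card_univ]
  have hne : (X ^ Fintype.card L - X : L[X]) ≠ 0 :=
    FiniteField.X_pow_card_sub_X_ne_zero L Fintype.one_lt_card
  obtain ⟨a, ha⟩ := (hsplit.of_dvd hne hdvd).exists_eval_eq_zero hf1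
  refine ⟨a, ?_⟩
  have h := hmap (evalRingHom a) g
  rw [coe_evalRingHom, eval_X] at h
  rw [hf, eval_sub, eval_pow, eval_X, h] at ha
  exact sub_eq_zero.1 ha

/-- An element whose conjugates have a dual system under the trace is normal. -/
lemma conjSpan_eq_top_of_trace {K L : Type*} [Field K] [Field L] [Algebra K L] [Fintype K]
    [Fintype L] {q n : ℕ} (hK : Fintype.card K = q) (hr : Module.finrank K L = n) (a b : L)
    (h : ∀ m < 2 * n, ∑ k ∈ Finset.range n, (b * a ^ q ^ m) ^ q ^ k
      = ((if m % n = 0 then 1 else 0 : ℕ) : L)) :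
    conjSpan K q n a = ⊤ := by
  have hφ : ∀ (k : ℕ) (x : L), (frobLin K L ^ k) x = x ^ q ^ k := by
    intro k x
    rw [frobLin_pow_apply, hK]
  have hli : LinearIndependent K fun i : Fin n => a ^ q ^ (i : ℕ) := by
    rw [Fintype.linearIndependent_iff]
    intro c hc j
    let T : L →ₗ[K] L := ∑ k ∈ Finset.range n, frobLin K L ^ k
    have hT : ∀ x, T x = ∑ k ∈ Finset.range n, x ^ q ^ k := by
      intro x
      rw [LinearMap.sum_apply]
      exact Finset.sum_congr rfl fun k _ => hφ k x
    have h1 : T (b * (frobLin K L ^ (n - (j : ℕ))) (∑ i, c i • a ^ q ^ (i : ℕ))) = 0 := by simp [hc]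
    rw [map_sum, Finset.mul_sum, map_sum] at h1
    have h2 : ∀ i : Fin n, T (b * (frobLin K L ^ (n - (j : ℕ))) (c i • a ^ q ^ (i : ℕ)))
        = if i = j then algebraMap K L (c i) else 0 := by
      intro i
      have hi := i.2
      have hj := j.2
      rw [map_smul, mul_smul_comm, map_smul, hφ, ← pow_mul, ← pow_add, hT, h _ (by omega),
        Algebra.smul_def]
      have hmod : ((i : ℕ) + (n - j)) % n = 0 ↔ i = j := by
        rw [← Nat.dvd_iff_mod_eq_zero, Fin.ext_iff]
        constructor
        · rintro ⟨k, hk⟩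
          have : k = 1 := by
            rcases k with _ | _ | k
            · omega
            · rfl
            · have : n * 2 ≤ n * (k + 1 + 1) := Nat.mul_le_mul_left n (by omega)
              omega
          subst this
          omega
        · intro hij
          exact ⟨1, by omega⟩
      simp only [hmod]
      split_ifs <;> simp
    rw [Finset.sum_congr rfl fun i _ => h2 i, Finset.sum_ite_eq' Finset.univ j] at h1
    simpa using h1
  exact hli.span_eq_top_of_card_eq_finrank' (by rw [Fintype.card_fin, hr])

theorem exists_of_normalRootCheck {K L : Type*} [Field K] [Field L] [Algebra K L] [Fintype K]
    [Fintype L] {p n : ℕ} (hp : p.Prime) (hodd : Odd p) (hn : 0 < n) (hK : Fintype.card K = p)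
    (hL : Fintype.card L = p ^ n) (hr : Module.finrank K L = n) (g b ps : List ℕ)
    (hlen : g.length = n) (hc : NormalRootCheck p g b ps) :
    ∃ α : L, orderOf α = (Fintype.card L - 1) / 2 ∧
      conjSpan K (Fintype.card K) (Module.finrank K L) α = ⊤ := by
  have : Fact p.Prime := ⟨hp⟩
  have : CharP L p := charP_of_card_eq_prime_pow hL
  subst hlen
  have hg0 : g ≠ [] := List.length_pos_iff.1 hn
  obtain ⟨hps, hdvd, hone, hpow, htr⟩ := hc
  have h2 : 2 ∣ p ^ g.length - 1 := (Nat.Odd.sub_odd hodd.pow odd_one).two_dvd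
  have hQ : p ^ g.length - 1 ≠ 0 := by
    have := Nat.one_lt_pow hn.ne' hp.one_lt
    omega
  obtain ⟨a, ha⟩ := exists_pow_length_eq_evalList (L := L) hg0 hL (Nat.div_dvd_of_dvd h2) hone
  have ha1 : evalList a [0, 1] = a := by simp [evalList]
  refine ⟨a, ?_, ?_⟩
  · rw [hL]
    set M := (p ^ g.length - 1) / 2 with hM
    refine orderOf_eq_of_pow_and_pow_div_prime (by omega) ?_ fun l hl hlM hone' => ?_
    · have h := hone.evalList_eq (a := a)
      rw [evalList_powList hg0 ha, ha1] at h
      exact_mod_cast h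
    · have hmem : l ∈ ps := by
        obtain ⟨r, hr, hlr⟩ := (Prime.dvd_prod_iff hl.prime).1 (hl.dvd_of_dvd_pow (hlM.trans hdvd))
        rwa [(Nat.prime_dvd_prime_iff_eq hl (hps r hr)).1 hlr]
      have h := (hpow l hmem).evalList_eq (a := a)
      have hp1 : ((p - 1 : ℕ) : L) = -1 := by
        rw [Nat.cast_sub hp.one_lt.le, CharP.cast_eq_zero]
        simp
      rw [evalList_powList hg0 ha, evalList_addList, evalList_powList hg0 ha, ha1, hone',
        evalList, evalList, hp1] at h
      simp [hQ] at h
  · rw [hr, hK]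
    refine conjSpan_eq_top_of_trace hK hr a (evalList a b) fun m hm => ?_
    have h := (htr m hm).evalList_eq (a := a)
    rw [evalList_traceList hg0 ha, evalList_mulList hg0 ha, evalList_conjList hg0 ha, ha1] at h
    exact h

end ExplicitElements

section Assembly

variable {K L : Type*} [Field K] [Field L] [Algebra K L] [Fintype K] [Fintype L]

theorem exists_of_card_three {n : ℕ} (hn : 3 ≤ n) (hn4 : n ≠ 4) (hK : Fintype.card K = 3)
    (hL : Fintype.card L = 3 ^ n) (hr : Module.finrank K L = n) :
    ∃ α : L, orderOf α = (Fintype.card L - 1) / 2 ∧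
      conjSpan K (Fintype.card K) (Module.finrank K L) α = ⊤ := by
  rcases le_or_gt 104 n with h | h
  · exact exists_of_card_eq_three h hK hL hr
  by_cases hmem : n ∈ ({3, 4, 6, 8} : Finset ℕ)
  · have root := exists_of_normalRootCheck (K := K) Nat.prime_three (by decide)
      ((Nat.zero_lt_succ 2).trans_le hn) hK hL hr
    simp only [Finset.mem_insert, Finset.mem_singleton, hn4, false_or] at hmem
    rcases hmem with rfl | rfl | rfl
    · exact root [1, 1, 1] [1, 1, 0] [13] rfl (by decide +kernel)
    · exact root [2, 1, 2, 0, 0, 1] [1, 1, 0, 2, 1, 1] [2, 7, 13] rfl (by decide +kernel)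
    · exact root [2, 1, 0, 1, 1, 0, 0, 1] [1, 2, 1, 2, 2, 2, 2, 2] [2, 5, 41] rfl
        (by decide +kernel)
  · exact exists_of_sieveCheckAny (by decide) le_rfl hn hK hL hr (sieveCheckAny_three n h hn hmem)

theorem exists_of_card_five {n : ℕ} (hn : 3 ≤ n) (hK : Fintype.card K = 5)
    (hL : Fintype.card L = 5 ^ n) (hr : Module.finrank K L = n) :
    ∃ α : L, orderOf α = (Fintype.card L - 1) / 2 ∧
      conjSpan K (Fintype.card K) (Module.finrank K L) α = ⊤ := by
  rcases le_or_gt 77 n with h | h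
  · exact exists_of_sq_bound (by decide) le_rfl hn hK hL hr (by norm_num) h
  by_cases hmem : n ∈ ({3, 4, 6, 8} : Finset ℕ)
  · have root := exists_of_normalRootCheck (K := K) Nat.prime_five (by decide)
      ((Nat.zero_lt_succ 2).trans_le hn) hK hL hr
    simp only [Finset.mem_insert, Finset.mem_singleton] at hmem
    rcases hmem with rfl | rfl | rfl | rfl
    · exact root [4, 2, 1] [1, 3, 0] [2, 31] rfl (by decide +kernel)
    · exact root [1, 1, 1, 1] [2, 3, 0, 0] [2, 3, 13] rfl (by decide +kernel)
    · exact root [1, 1, 4, 0, 0, 1] [0, 3, 2, 3, 2, 4] [2, 3, 7, 31] rfl (by decide +kernel)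
    · exact root [1, 4, 0, 1, 0, 0, 0, 1] [3, 0, 4, 2, 1, 0, 2, 1] [2, 3, 13, 313] rfl
        (by decide +kernel)
  · exact exists_of_sieveCheckAny (by decide) (by norm_num) hn hK hL hr
      (sieveCheckAny_five n h hn hmem)

theorem exists_of_card_seven {n : ℕ} (hn : 3 ≤ n) (hK : Fintype.card K = 7)
    (hL : Fintype.card L = 7 ^ n) (hr : Module.finrank K L = n) :
    ∃ α : L, orderOf α = (Fintype.card L - 1) / 2 ∧
      conjSpan K (Fintype.card K) (Module.finrank K L) α = ⊤ := by
  rcases le_or_gt 36 n with h | h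
  · exact exists_of_sq_bound (by decide) (by norm_num) hn hK hL hr (by norm_num) h
  by_cases hmem : n ∈ ({3, 4, 6} : Finset ℕ)
  · have root := exists_of_normalRootCheck (K := K) Nat.prime_seven (by decide)
      ((Nat.zero_lt_succ 2).trans_le hn) hK hL hr
    simp only [Finset.mem_insert, Finset.mem_singleton] at hmem
    rcases hmem with rfl | rfl | rfl
    · exact root [4, 5, 1] [6, 4, 0] [3, 19] rfl (by decide +kernel)
    · exact root [3, 0, 2, 1] [0, 2, 4, 5] [2, 3, 5] rfl (by decide +kernel)
    · exact root [5, 1, 0, 0, 0, 1] [0, 2, 3, 0, 2, 6] [2, 3, 19, 43] rfl (by decide +kernel)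
  · exact exists_of_sieveCheckAny (by decide) (by norm_num) hn hK hL hr
      (sieveCheckAny_seven n h hn hmem)

theorem exists_of_card_nine {n : ℕ} (hn : 3 ≤ n) (hK : Fintype.card K = 9)
    (hL : Fintype.card L = 9 ^ n) (hr : Module.finrank K L = n) :
    ∃ α : L, orderOf α = (Fintype.card L - 1) / 2 ∧
      conjSpan K (Fintype.card K) (Module.finrank K L) α = ⊤ := by
  rcases le_or_gt 28 n with h | h
  · exact exists_of_sq_bound (by decide) (by norm_num) hn hK hL hr (by norm_num) h
  · exact exists_of_sieveCheckAny (by decide) (by norm_num) hn hK hL hr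
      (sieveCheckAny_nine n h hn)

theorem exists_of_card_eleven {n : ℕ} (hn : 3 ≤ n) (hK : Fintype.card K = 11)
    (hL : Fintype.card L = 11 ^ n) (hr : Module.finrank K L = n) :
    ∃ α : L, orderOf α = (Fintype.card L - 1) / 2 ∧
      conjSpan K (Fintype.card K) (Module.finrank K L) α = ⊤ := by
  rcases le_or_gt 26 n with h | h
  · exact exists_of_sq_bound (by decide) (by norm_num) hn hK hL hr (by norm_num) h
  · exact exists_of_sieveCheckAny (by decide) (by norm_num) hn hK hL hr
      (sieveCheckAny_eleven n h hn)

theorem exists_of_card_thirteen {n : ℕ} (hn : 3 ≤ n) (hK : Fintype.card K = 13)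
    (hL : Fintype.card L = 13 ^ n) (hr : Module.finrank K L = n) :
    ∃ α : L, orderOf α = (Fintype.card L - 1) / 2 ∧
      conjSpan K (Fintype.card K) (Module.finrank K L) α = ⊤ := by
  rcases le_or_gt 24 n with h | h
  · exact exists_of_sq_bound (by decide) (by norm_num) hn hK hL hr (by norm_num) h
  by_cases h4 : n = 4
  · subst h4
    exact exists_of_normalRootCheck (by norm_num) (by decide) (by norm_num) hK hL hr
      [3, 0, 0, 1] [12, 9, 6, 3] [2, 3, 5, 7, 17] rfl (by decide +kernel)
  · exact exists_of_sieveCheckAny (by decide) (by norm_num) hn hK hL hr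
      (sieveCheckAny_thirteen n h hn h4)

theorem exists_of_seventeen_le_card {q n : ℕ} (hodd : Odd q) (hq : 17 ≤ q) (hn : 3 ≤ n)
    (hK : Fintype.card K = q) (hL : Fintype.card L = q ^ n) (hr : Module.finrank K L = n) :
    ∃ α : L, orderOf α = (Fintype.card L - 1) / 2 ∧
      conjSpan K (Fintype.card K) (Module.finrank K L) α = ⊤ := by
  rcases le_or_gt q n with h | h
  · exact exists_of_seventeen_le_card_le_finrank hodd hq h hK hL hr
  obtain ⟨c3, c4, c5, c6⟩ := sieveCheckAny_of_seventeen_le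
  have hmod := Nat.odd_iff.1 hodd
  by_cases hc : SieveCheckAny q n
  · exact exists_of_sieveCheckAny hodd (by omega) hn hK hL hr hc
  refine exists_of_finrank_lt_card hodd hq hn h ?_ ?_ ?_ ?_ hK hL hr <;>
    · rintro rfl
      by_contra! hle
      first
        | exact hc (c3 q (by omega) hq hmod)
        | exact hc (c4 q (by omega) hq hmod)
        | exact hc (c5 q (by omega) hq hmod)
        | exact hc (c6 q (by omega) hq hmod)

end Assembly

/-- Let `q` be a power of an odd prime `p` and `n ≥ 3` with `(q, n) ≠ (3, 4)`. Then there
exists `α ∈ F_{q^n}` that is simultaneously `2`-primitive and normal over `F_q`. -/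
theorem stmt_0 (p t q n : ℕ) (hp : p.Prime) (hodd : Odd p) (ht : 1 ≤ t)
    (hq : q = p ^ t) (hn : 3 ≤ n) (hexc : ¬(q = 3 ∧ n = 4))
    (K L : Type*) [Field K] [Field L] [Algebra K L] [Fintype K] [Fintype L]
    (hK : Fintype.card K = q) (hL : Fintype.card L = q ^ n) :
    ∃ α : L, orderOf α = (q ^ n - 1) / 2 ∧ conjSpan K q n α = ⊤ := by
  have hqodd : Odd q := hq ▸ hodd.pow
  have hq1 : 1 < q := hq ▸ Nat.one_lt_pow (by omega) hp.one_lt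
  have hr : Module.finrank K L = n := by
    have h := Module.card_eq_pow_finrank (K := K) (V := L)
    rw [hK, hL] at h
    exact (Nat.pow_right_injective hq1 h).symm
  suffices h : ∃ α : L, orderOf α = (Fintype.card L - 1) / 2 ∧
      conjSpan K (Fintype.card K) (Module.finrank K L) α = ⊤ by
    rwa [hL, hK, hr] at h
  rcases le_or_gt 17 q with h17 | h17
  · exact exists_of_seventeen_le_card hqodd h17 hn hK hL hr
  have h15 : q ≠ 15 := by
    rintro h
    rw [h] at hq
    have h3 := Nat.prime_three.dvd_of_dvd_pow (hq ▸ (by norm_num : 3 ∣ 15))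
    have h5 := Nat.prime_five.dvd_of_dvd_pow (hq ▸ (by norm_num : 5 ∣ 15))
    rw [Nat.prime_dvd_prime_iff_eq Nat.prime_three hp] at h3
    rw [Nat.prime_dvd_prime_iff_eq Nat.prime_five hp] at h5
    omega
  have hmod := Nat.odd_iff.1 hqodd
  have hcases : q = 3 ∨ q = 5 ∨ q = 7 ∨ q = 9 ∨ q = 11 ∨ q = 13 := by omega
  rcases hcases with h | h | h | h | h | h <;> rw [h] at hK hL
  · exact exists_of_card_three hn (fun h4 => hexc ⟨h, h4⟩) hK hL hr
  · exact exists_of_card_five hn hK hL hr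
  · exact exists_of_card_seven hn hK hL hr
  · exact exists_of_card_nine hn hK hL hr
  · exact exists_of_card_eleven hn hK hL hr
  · exact exists_of_card_thirteen hn hK hL hr
end

section
/- There is no element of F_{3^4} that is simultaneously 2-primitive (i.e., of multiplicative order (3^4 − 1)/2 = 40) and normal over F_3. -/
/-- In characteristic `3`, an element of order `40` satisfies a nontrivial linear relation with
coefficients `±1` among its conjugates over the prime field. -/
theorem conj_relation_of_orderOf_eq_forty {L : Type*} [Field L] (h3 : (3 : L) = 0) {α : L}
    (hα : orderOf α = 40) :
    α + α ^ 3 + α ^ 9 + α ^ 27 = 0 ∨ α - α ^ 3 + α ^ 9 - α ^ 27 = 0 := by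
  have h40 : α ^ 40 = 1 := hα ▸ pow_orderOf_eq_one α
  have h20 : α ^ 20 ≠ 1 := pow_ne_one_of_lt_orderOf (by norm_num) (by omega)
  have h8 : α ^ 8 ≠ 1 := pow_ne_one_of_lt_orderOf (by norm_num) (by omega)
  have h20' : α ^ 20 + 1 = 0 := by
    refine (mul_eq_zero.mp ?_).resolve_left (sub_ne_zero.mpr h20)
    linear_combination h40
  have h4 : α ^ 4 + 1 ≠ 0 := fun h => h8 (by linear_combination (α ^ 4 - 1) * h)
  have hcyc : α ^ 16 - α ^ 12 + α ^ 8 - α ^ 4 + 1 = 0 := by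
    refine (mul_eq_zero.mp ?_).resolve_left h4
    linear_combination h20'
  refine mul_eq_zero.mp ?_
  linear_combination α ^ 2 * hcyc + α ^ 10 * h3 -
    α ^ 10 * (α ^ 24 - α ^ 4 + 2) * h20'

/-- There is no element of `F_{3^4}` that is simultaneously `2`-primitive (of multiplicative
order `40`) and normal over `F_3`. -/
theorem stmt_1 (K L : Type*) [Field K] [Field L] [Algebra K L] [Fintype K] [Fintype L]
    (hK : Fintype.card K = 3) (hL : Fintype.card L = 3 ^ 4) :
    ¬ ∃ α : L, orderOf α = 40 ∧ conjSpan K 3 4 α = ⊤ := by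
  rintro ⟨α, hα, hspan⟩
  have h3 : (3 : L) = 0 := by
    have h := Nat.cast_card_eq_zero L
    rw [hL] at h
    exact pow_eq_zero_iff (n := 4) (by norm_num) |>.mp (by exact_mod_cast h)
  have hrank : Module.finrank K L = 4 := by
    have h := Module.card_eq_pow_finrank (K := K) (V := L)
    rw [hK, hL] at h
    exact (Nat.pow_right_injective (by norm_num : 2 ≤ 3) h).symm
  have hli : LinearIndependent K fun i : Fin 4 => α ^ 3 ^ (i : ℕ) :=
    linearIndependent_of_top_le_span_of_card_eq_finrank hspan.ge (by simp [hrank])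
  rw [Fintype.linearIndependent_iff] at hli
  rcases conj_relation_of_orderOf_eq_forty h3 hα with h | h
  · have := hli ![1, 1, 1, 1] (by simpa [Fin.sum_univ_four] using h) 0
    simp at this
  · have := hli ![1, -1, 1, -1] (by simpa [Fin.sum_univ_four, sub_eq_add_neg] using h) 0
    simp at this
end
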